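/- arXiv:1104.0388 — 6 statements merged into one kernel-verified Lean document; each statement's English description precedes it below -/
import Mathlib

section
/- Let k ≥ 4 and let ω = u·a·(∏_{i=1}^{k−3} b^{k−1}a^{k−1}·a^i·a·b^{k−2−i}·b^{k−1}a^{k−1}·a)·v, i.e. ω = b a^{k−1} a (b^{k−1} a^{k−1} a^i a b^{k−2−i} b^{k−1} a^{k−1} a concatenated for i = 1, …, k−3) b^{k−1} a. Then ω ∉ Fact(S_k*) (so in particular S_k is not complete) and |ω| = 5k² − 17k + 13. -/
namespace Restivo

/-- Words over the two-letter alphabet Σ = {a, b}, encoded as lists of booleans. -/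
abbrev Word := List Bool

/-- The letter `a`. -/
def a : Bool := false

/-- The letter `b`. -/
def b : Bool := true

/-- Kleene star: all finite concatenations of words from `S` (including the empty word). -/
def kstar (S : Set Word) : Set Word :=
  { w | ∃ L : List Word, (∀ x ∈ L, x ∈ S) ∧ L.flatten = w }

/-- Prefixes of words of `L`. -/
def Pref (L : Set Word) : Set Word := { w | ∃ z : Word, w ++ z ∈ L }

/-- Factors (contiguous subwords) of words of `L`. -/
def Facts (L : Set Word) : Set Word := { w | ∃ x y : Word, x ++ w ++ y ∈ L }

/-- The word u = b a^(k-1). -/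
def u (k : ℕ) : Word := b :: List.replicate (k - 1) a

/-- The word v = b^(k-1) a. -/
def v (k : ℕ) : Word := List.replicate (k - 1) b ++ [a]

/-- The set S_k = (Σ^k \ {u, v}) ∪ (Σ^(k-1) \ {a^(k-1), b^(k-1)}). -/
def Sk (k : ℕ) : Set Word :=
  { w | w.length = k ∧ w ≠ u k ∧ w ≠ v k } ∪
  { w | w.length = k - 1 ∧ w ≠ List.replicate (k - 1) a ∧ w ≠ List.replicate (k - 1) b }

/-- Position `j` is forbidden in `w` w.r.t. `S` if the suffix of `w` starting from
position `j` is not a prefix of any word of `S*`. -/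
def Forbidden (S : Set Word) (w : Word) (j : ℕ) : Prop :=
  w.drop j ∉ Pref (kstar S)

/-- The word `p` occurs in `w` at position `s`. -/
def OccursAt (p w : Word) (s : ℕ) : Prop :=
  s + p.length ≤ w.length ∧ (w.drop s).take p.length = p

/-- The set of (locally enumerated) forbidden positions of the occurrence of `p`
at position `s` in `w`, with respect to `S_k`. -/
def Focc (k : ℕ) (w p : Word) (s : ℕ) : Set ℕ :=
  { i | i < p.length ∧ Forbidden (Sk k) w (s + i) }

/-- Two occurrences (of words from {u, v}) at positions `s < t` in `w` are
consecutive: no word from {u, v} occurs at a position strictly between them. -/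
def Consecutive (k : ℕ) (w : Word) (s t : ℕ) : Prop :=
  s < t ∧ ∀ m, s < m → m < t → ¬ OccursAt (u k) w m ∧ ¬ OccursAt (v k) w m

/-- `w` is a minimal uncompletable word for `S`. -/
def MinUncompletable (S : Set Word) (w : Word) : Prop :=
  w ∉ Facts (kstar S) ∧ ∀ w' : Word, w' ∉ Facts (kstar S) → w.length ≤ w'.length

/-- r = b^(k-1) a^(k-1), the overlap of v and u. -/
def r (k : ℕ) : Word := List.replicate (k - 1) b ++ List.replicate (k - 1) a

/-- ω = u a (∏_{i=1}^{k-3} b^(k-1) a^(k-1) a^i a b^(k-2-i) b^(k-1) a^(k-1) a) v. -/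
def omega (k : ℕ) : Word :=
  u k ++ [a] ++
    (((List.range (k - 3)).map (fun i =>
      r k ++ List.replicate (i + 1) a ++ [a] ++
        List.replicate (k - 2 - (i + 1)) b ++ r k ++ [a])).flatten) ++ v k

theorem Forbidden.lt_length {S : Set Word} {w : Word} {p : ℕ} (h : Forbidden S w p) :
    p < w.length := by
  by_contra! hp
  refine h ⟨[], [], by simp, ?_⟩
  simp [List.drop_eq_nil_of_le hp]

theorem forbidden_append {S : Set Word} (B T : Word) {p j : ℕ} (hp : p = B.length + j) :
    Forbidden S (B ++ T) p ↔ Forbidden S T j := by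
  subst hp
  simp [Forbidden]

theorem Forbidden.of_step {k : ℕ} (hk : 4 ≤ k) {w : Word} {p : ℕ} (hlen : p + k ≤ w.length)
    (h1 : (w.drop p).take k = u k ∨ (w.drop p).take k = v k ∨ Forbidden (Sk k) w (p + k))
    (h2 : (∃ c, (w.drop p).take (k - 1) = List.replicate (k - 1) c) ∨
      Forbidden (Sk k) w (p + (k - 1))) :
    Forbidden (Sk k) w p := by
  rintro ⟨z, L, hL, hflat⟩
  rcases L with _ | ⟨x, L⟩
  · have := congrArg List.length hflat
    simp at this
    omega
  have hx := hL x (by simp)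
  have hL' : ∀ y ∈ L, y ∈ Sk k := fun y hy => hL y (by simp [hy])
  have key : ∀ l, x.length = l → l ≤ k →
      x = (w.drop p).take l ∧ ¬ Forbidden (Sk k) w (p + l) := by
    intro l hl hlk
    have hle : l ≤ (w.drop p).length := by simp; omega
    rw [List.flatten_cons] at hflat
    constructor
    · have := congrArg (List.take l) hflat
      rwa [List.take_append_of_le_length hle, ← hl, List.take_left, hl] at this
    · have := congrArg (List.drop l) hflat
      rw [List.drop_append_of_le_length hle, ← hl, List.drop_left, hl, List.drop_drop] at this
      exact fun hF => hF ⟨z, L, hL', this⟩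
  rcases hx with ⟨hl, hu, hv⟩ | ⟨hl, ha, hb⟩
  · obtain ⟨hxe, hF⟩ := key k hl le_rfl
    rw [← hxe] at h1
    tauto
  · obtain ⟨hxe, hF⟩ := key (k - 1) hl (by omega)
    rw [← hxe] at h2
    rcases h2 with ⟨_ | _, h⟩ | h
    · exact ha h
    · exact hb h
    · exact hF h

theorem take_drop_eq_replicate {w : Word} {p n : ℕ} {c : Bool}
    (h : ∀ j, p ≤ j → j < p + n → w[j]? = some c) :
    (w.drop p).take n = List.replicate n c := by
  apply List.ext_getElem?
  intro j
  rw [List.getElem?_take, List.getElem?_replicate, List.getElem?_drop]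
  split_ifs with hj
  · exact h _ (by omega) (by omega)
  · rfl

section Rules

variable {k : ℕ} {w : Word} {p : ℕ}

theorem forbidden_of_both (hk : 4 ≤ k) (h1 : Forbidden (Sk k) w (p + (k - 1)))
    (h2 : Forbidden (Sk k) w (p + k)) : Forbidden (Sk k) w p :=
  .of_step hk h2.lt_length.le (.inr (.inr h2)) (.inr h1)

theorem forbidden_of_power (hk : 4 ≤ k) {c : Bool}
    (h : ∀ j, p ≤ j → j < p + (k - 1) → w[j]? = some c)
    (h2 : Forbidden (Sk k) w (p + k)) : Forbidden (Sk k) w p :=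
  .of_step hk h2.lt_length.le (.inr (.inr h2)) (.inl ⟨c, take_drop_eq_replicate h⟩)

theorem forbidden_of_u (hk : 4 ≤ k) (hb : w[p]? = some b)
    (h : ∀ j, p < j → j < p + k → w[j]? = some a)
    (h1 : Forbidden (Sk k) w (p + (k - 1))) : Forbidden (Sk k) w p := by
  have hlen : p + k ≤ w.length := by
    have := (List.getElem?_eq_some_iff.1 (h (p + (k - 1)) (by omega) (by omega))).1
    omega
  refine .of_step hk hlen (.inl ?_) (.inr h1)
  apply List.ext_getElem?
  intro j
  rw [List.getElem?_take, List.getElem?_drop, u]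
  rcases j with _ | j
  · simp [hb]; omega
  · rw [List.getElem?_cons_succ, List.getElem?_replicate]
    split_ifs <;> first | omega | rfl | exact h _ (by omega) (by omega)

theorem forbidden_of_v (hk : 4 ≤ k)
    (h : ∀ j, p ≤ j → j < p + (k - 1) → w[j]? = some b)
    (ha : w[p + (k - 1)]? = some a) : Forbidden (Sk k) w p := by
  have hlen : p + k ≤ w.length := by
    have := (List.getElem?_eq_some_iff.1 ha).1
    omega
  refine .of_step hk hlen (.inr (.inl ?_)) (.inl ⟨b, take_drop_eq_replicate h⟩)
  have hk1 : k = k - 1 + 1 := by omega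
  rw [v, hk1, List.take_add_one, Nat.add_sub_cancel, take_drop_eq_replicate h,
    List.getElem?_drop, ha]
  rfl

end Rules

/-- `b^(k-1)` followed by a word starts with forbidden positions `0` and `i, …, k-2`;
for `i = k-2` only position `0` is required. -/
def ForbiddenFrom (k i : ℕ) (T : Word) : Prop :=
  ∀ j, j = 0 ∨ (i ≤ j ∧ j ≤ k - 2 ∧ i ≤ k - 3) → Forbidden (Sk k) T j

/-- The block with parameter `i`, in run-length form. -/
def block (k i : ℕ) : Word :=
  List.replicate (k - 1) b ++ List.replicate (k + i) a ++
    List.replicate (2 * k - 3 - i) b ++ List.replicate k a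

theorem length_block {k i : ℕ} (hk : 4 ≤ k) (hi : i ≤ k - 3) :
    (block k i).length = 5 * k - 4 := by
  simp [block]; omega

theorem block_eq {k i : ℕ} (hk : 4 ≤ k) (hi : i + 1 ≤ k - 3) :
    r k ++ List.replicate (i + 1) a ++ [a] ++ List.replicate (k - 2 - (i + 1)) b ++ r k ++ [a] =
      block k (i + 1) := by
  have h1 : k + (i + 1) = (k - 1) + (i + 1) + 1 := by omega
  have h2 : 2 * k - 3 - (i + 1) = (k - 2 - (i + 1)) + (k - 1) := by omega
  have h3 : List.replicate k a = List.replicate (k - 1) a ++ [a] := by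
    rw [← List.replicate_succ']; congr 1; omega
  rw [block, h3, h1, h2]
  simp only [r, List.replicate_add, List.append_assoc, List.replicate_one]

theorem getElem?_block_append {k i : ℕ} (hk : 4 ≤ k) (T : Word) {j : ℕ}
    (hj : j < 5 * k - 4) :
    (block k i ++ T)[j]? =
      some (if j < k - 1 then b else if j < 2 * k - 1 + i then a else
        if j < 4 * k - 4 then b else a) := by
  simp only [block, List.getElem?_append, List.getElem?_replicate, List.length_append,
    List.length_replicate]
  split_ifs <;> first | omega | rfl

theorem ForbiddenFrom.block_append {k i : ℕ} (hk : 4 ≤ k) (hi : i ≤ k - 3) {T : Word}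
    (hT : ForbiddenFrom k (i + 1) T) : ForbiddenFrom k i (block k i ++ T) := by
  set w := block k i ++ T with hw
  have lb1 : ∀ j, j < k - 1 → w[j]? = some b := fun j hj => by
    rw [hw, getElem?_block_append hk T (by omega)]; grind
  have la1 : ∀ j, k - 1 ≤ j → j < 2 * k - 1 + i → w[j]? = some a := fun j hj hj' => by
    rw [hw, getElem?_block_append hk T (by omega)]; grind
  have lb2 : ∀ j, 2 * k - 1 + i ≤ j → j < 4 * k - 4 → w[j]? = some b := fun j hj hj' => by
    rw [hw, getElem?_block_append hk T (by omega)]; grind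
  have la2 : ∀ j, 4 * k - 4 ≤ j → j < 5 * k - 4 → w[j]? = some a := fun j hj hj' => by
    rw [hw, getElem?_block_append hk T (by omega)]; grind
  have tail : ∀ p j, p = 5 * k - 4 + j → (j = 0 ∨ (i + 1 ≤ j ∧ j ≤ k - 2 ∧ i + 1 ≤ k - 3)) →
      Forbidden (Sk k) w p := fun p j hp hj =>
    (forbidden_append _ _ (by rw [length_block hk hi, hp])).2 (hT j hj)
  have hA0 : Forbidden (Sk k) w (4 * k - 4) :=
    forbidden_of_power hk (fun j _ _ => la2 j (by omega) (by omega))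
      (tail _ 0 (by omega) (.inl rfl))
  have hA : ∀ p, 4 * k - 4 + (i + 2) ≤ p → p ≤ 4 * k - 4 + (k - 2) → Forbidden (Sk k) w p :=
    fun p _ _ => forbidden_of_both hk (tail _ (p - (4 * k - 4) - 1) (by omega) (by omega))
      (tail _ (p - (4 * k - 4)) (by omega) (by omega))
  have hB1 : ∀ p, 3 * k - 1 + i ≤ p → p ≤ 4 * k - 4 → Forbidden (Sk k) w p := by
    intro p h1 h2
    rcases (by omega : p = 4 * k - 4 ∨ p = 4 * k - 5 ∨ p < 4 * k - 5) with rfl | rfl | h3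
    · exact hA0
    · exact forbidden_of_u hk (lb2 _ (by omega) (by omega))
        (fun j _ _ => la2 j (by omega) (by omega)) (hA _ (by omega) (by omega))
    · exact forbidden_of_both hk (hA _ (by omega) (by omega)) (hA _ (by omega) (by omega))
  have hB : ∀ p, 2 * k - 1 + i ≤ p → p ≤ 3 * k - 3 → Forbidden (Sk k) w p := by
    intro p h1 h2
    rcases (by omega : p = 3 * k - 3 ∨ p < 3 * k - 3) with rfl | h3
    · exact forbidden_of_v hk (fun j _ _ => lb2 j (by omega) (by omega))
        (la2 _ (by omega) (by omega))
    · exact forbidden_of_power hk (fun j _ _ => lb2 j (by omega) (by omega))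
        (hB1 _ (by omega) (by omega))
  have hC : ∀ p, k + i - 1 ≤ p → p ≤ 2 * k - 3 → Forbidden (Sk k) w p := by
    intro p h1 h2
    rcases le_or_gt p (k + i) with h3 | h3
    · exact forbidden_of_power hk (fun j _ _ => la1 j (by omega) (by omega))
        (hB _ (by omega) (by omega))
    · exact forbidden_of_both hk (hB _ (by omega) (by omega)) (hB _ (by omega) (by omega))
  rintro p (rfl | ⟨h1, h2, -⟩)
  · exact forbidden_of_v hk (fun j _ _ => lb1 j (by omega)) (la1 _ (by omega) (by omega))
  rcases (by omega : p = k - 2 ∨ p < k - 2) with rfl | h3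
  · exact forbidden_of_u hk (lb1 _ (by omega))
      (fun j _ _ => la1 j (by omega) (by omega)) (hC _ (by omega) (by omega))
  · exact forbidden_of_both hk (hC _ (by omega) (by omega)) (hC _ (by omega) (by omega))

theorem forbiddenFrom_v {k : ℕ} (hk : 4 ≤ k) : ForbiddenFrom k (k - 2) (v k) := by
  rintro j (rfl | h)
  · refine forbidden_of_v hk (fun j _ _ => ?_) ?_
    · rw [v, List.getElem?_append_left (by simp; omega), List.getElem?_replicate]
      grind
    · simp [v]
  · omega

theorem forbiddenFrom_blocks {k : ℕ} (hk : 4 ≤ k) (m : ℕ) :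
    ∀ s, s + m = k - 3 → ForbiddenFrom k (s + 1)
      (((List.range' s m).map (fun i => block k (i + 1))).flatten ++ v k) := by
  induction m with
  | zero =>
    intro s hs
    have : s + 1 = k - 2 := by omega
    simpa [this] using forbiddenFrom_v hk
  | succ m ih =>
    intro s hs
    rw [List.range'_succ, List.map_cons, List.flatten_cons, List.append_assoc]
    exact (ih (s + 1) (by omega)).block_append hk (by omega)

theorem omega_eq {k : ℕ} (hk : 4 ≤ k) :
    omega k = (u k ++ [a]) ++
      (((List.range' 0 (k - 3)).map (fun i => block k (i + 1))).flatten ++ v k) := by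
  rw [omega, List.append_assoc, ← List.range_eq_range']
  congr 3
  refine List.map_congr_left fun i hi => block_eq hk ?_
  have := List.mem_range.1 hi
  omega

theorem forbidden_omega {k : ℕ} (hk : 4 ≤ k) {p : ℕ} (hp : p < k) :
    Forbidden (Sk k) (omega k) p := by
  have hT := forbiddenFrom_blocks hk (k - 3) 0 (by omega)
  rw [omega_eq hk]
  set T := ((List.range' 0 (k - 3)).map (fun i => block k (i + 1))).flatten ++ v k
  have hlen : (u k ++ [a]).length = k + 1 := by simp [u]; omega
  have tail : ∀ q, k + 1 ≤ q → q ≤ 2 * k - 1 → Forbidden (Sk k) ((u k ++ [a]) ++ T) q :=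
    fun q _ _ => (forbidden_append _ _ (j := q - (k + 1)) (by omega)).2 (hT _ (by omega))
  have la : ∀ j, 1 ≤ j → j < k + 1 → ((u k ++ [a]) ++ T)[j]? = some a := by
    intro j h1 h2
    obtain ⟨j, rfl⟩ : ∃ i, j = i + 1 := ⟨j - 1, by omega⟩
    rw [List.getElem?_append_left (by omega), u, List.cons_append, List.getElem?_cons_succ,
      ← List.replicate_succ', List.getElem?_replicate]
    grind
  have pos : ∀ q, 1 ≤ q → q < k → Forbidden (Sk k) ((u k ++ [a]) ++ T) q := by
    intro q h1 h2
    rcases (by omega : q = 1 ∨ 2 ≤ q) with rfl | h3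
    · exact forbidden_of_power hk (fun j _ _ => la j (by omega) (by omega))
        (tail _ (by omega) (by omega))
    · exact forbidden_of_both hk (tail _ (by omega) (by omega)) (tail _ (by omega) (by omega))
  rcases Nat.eq_zero_or_pos p with rfl | h
  · exact forbidden_of_u hk (by simp [u]) (fun j _ _ => la j (by omega) (by omega))
      (pos _ (by omega) (by omega))
  · exact pos p h hp

theorem exists_drop_mem_kstar {S : Set Word} {k : ℕ} (hk : 0 < k) (hS : ∀ s ∈ S, s.length ≤ k)
    {w : Word} (hw : k ≤ w.length) (L : List Word) (hL : ∀ x ∈ L, x ∈ S) :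
    ∀ x : Word, L.flatten = x ++ w → ∃ j < k, w.drop j ∈ kstar S := by
  induction L with
  | nil =>
    intro x hx
    have := congrArg List.length hx
    simp at this
    omega
  | cons s L ih =>
    intro x hx
    have hL' : ∀ x ∈ L, x ∈ S := fun y hy => hL y (by simp [hy])
    rcases List.eq_nil_or_concat x with rfl | ⟨x', c, hxc⟩
    · exact ⟨0, hk, s :: L, hL, by simpa using hx⟩
    rw [List.flatten_cons, List.append_eq_append_iff] at hx
    rcases hx with ⟨x'', rfl, h⟩ | ⟨t, rfl, rfl⟩
    · exact ih hL' x'' h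
    · have := hS _ (hL (x ++ t) (by simp))
      refine ⟨t.length, ?_, L, hL', by simp⟩
      simp [hxc] at this
      omega

theorem length_omega {k : ℕ} (hk : 4 ≤ k) :
    (omega k).length = 5 * k ^ 2 - 17 * k + 13 := by
  have key : ∀ m s, s + m = k - 3 →
      (((List.range' s m).map (fun i => block k (i + 1))).flatten).length = m * (5 * k - 4) := by
    intro m
    induction m with
    | zero => simp
    | succ m ih =>
      intro s hs
      rw [List.range'_succ, List.map_cons, List.flatten_cons, List.length_append,
        ih _ (by omega), length_block hk (by omega)]
      ring
  rw [omega_eq hk, List.length_append, List.length_append (bs := v k), key _ 0 (by omega)]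
  obtain ⟨n, rfl⟩ : ∃ n, k = n + 4 := ⟨k - 4, by omega⟩
  have h1 : n + 4 - 3 = n + 1 := by omega
  have h2 : 5 * (n + 4) - 4 = 5 * n + 16 := by omega
  have h3 : 5 * (n + 4) ^ 2 = 17 * (n + 4) + (5 * n ^ 2 + 23 * n + 12) := by ring
  rw [h1, h2, h3, Nat.add_sub_cancel_left]
  simp [u, v]
  ring

theorem statement0 (k : ℕ) (hk : 4 ≤ k) :
    omega k ∉ Facts (kstar (Sk k)) ∧ (omega k).length = 5 * k ^ 2 - 17 * k + 13 := by
  refine ⟨?_, length_omega hk⟩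
  rintro ⟨x, y, L, hL, hflat⟩
  have hlen : k ≤ (omega k).length := by
    have := (forbidden_omega hk (p := k - 1) (by omega)).lt_length
    omega
  have hS : ∀ s ∈ Sk k, s.length ≤ k := by
    rintro s (⟨h, -⟩ | ⟨h, -⟩) <;> omega
  obtain ⟨j, hj, hmem⟩ := exists_drop_mem_kstar (w := omega k ++ y) (by omega) hS
    (by simp; omega) L hL x (by simpa using hflat)
  rw [List.drop_append_of_le_length (by omega)] at hmem
  exact forbidden_omega hk hj ⟨y, hmem⟩

end Restivo
end

section
/- Let k ≥ 4. The minimal length of a word over Σ = {a,b} not belonging to Fact(S_k*) is exactly 5k² − 17k + 13; that is, some word of length 5k² − 17k + 13 is uncompletable for S_k and every word of smaller length belongs to Fact(S_k*). -/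
namespace Restivo

set_option linter.unusedSectionVars false

section Cyclic

variable {k : ℕ} [NeZero k]

/-- The set `B` of residues is a cyclic interval: it has at most one starting point. -/
def IsArc (B : Finset (ZMod k)) : Prop :=
  ∀ p ∈ B, ∀ q ∈ B, p - 1 ∉ B → q - 1 ∉ B → p = q

/-- The set `B` of residues is a cyclic interval with last element `r`. -/
def IsArcTo (B : Finset (ZMod k)) (r : ZMod k) : Prop :=
  IsArc B ∧ r ∈ B ∧ r + 1 ∉ B

lemma eq_univ_of_pred_mem {B : Finset (ZMod k)} (hne : B.Nonempty)
    (h : ∀ r ∈ B, r - 1 ∈ B) : B = Finset.univ := by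
  obtain ⟨r, hr⟩ := hne
  have key : ∀ n : ℕ, r - n ∈ B := by
    intro n
    induction n with
    | zero => simpa using hr
    | succ n ih =>
      have := h _ ih
      push_cast
      rwa [← sub_sub]
  ext q
  simp only [Finset.mem_univ, iff_true]
  have := key (r - q).val
  simpa using this

lemma exists_start {B : Finset (ZMod k)} (hne : B.Nonempty) (hu : B ≠ Finset.univ) :
    ∃ p ∈ B, p - 1 ∉ B := by
  by_contra! h
  exact hu (eq_univ_of_pred_mem hne h)

lemma IsArc.eq_singleton {B : Finset (ZMod k)} (hB : IsArc B) {p : ZMod k} (hp : p ∈ B)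
    (hp' : p - 1 ∉ B) (hs : p + 1 ∉ B) : B = {p} := by
  by_contra hne
  have hne' : (B.erase p).Nonempty := by
    rw [Finset.nonempty_iff_ne_empty]
    intro h0
    rw [Finset.erase_eq_empty_iff] at h0
    rcases h0 with h0 | h0
    · simp [h0] at hp
    · exact hne h0
  have := eq_univ_of_pred_mem hne' (by
    intro r hr
    rw [Finset.mem_erase] at hr ⊢
    refine ⟨?_, ?_⟩
    · rintro rfl
      apply hs
      simpa using hr.2
    · by_contra h
      exact hr.1 (hB r hr.2 p hp h hp'))
  have hmem : p ∈ B.erase p := by rw [this]; exact Finset.mem_univ p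
  simp at hmem

lemma IsArc.card_add_one {B : Finset (ZMod k)} (hB : IsArc B) {p : ZMod k} (hp : p ∈ B)
    (hp' : p - 1 ∉ B) (hs : p - 1 - 1 ∈ B) : B.card + 1 = k := by
  have := eq_univ_of_pred_mem (B := insert (p - 1) B) ⟨p, by simp [hp]⟩ (by
    intro r hr
    rw [Finset.mem_insert] at hr ⊢
    rcases hr with rfl | hr
    · exact Or.inr hs
    · by_cases h : r - 1 ∈ B
      · exact Or.inr h
      · left; rw [hB r hr p hp h hp'])
  rw [← Finset.card_insert_of_notMem hp', this, Finset.card_univ, ZMod.card]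

lemma IsArc.end_unique {B : Finset (ZMod k)} (hB : IsArc B) {e f : ZMod k} (he : e ∈ B)
    (hf : f ∈ B) (he' : e + 1 ∉ B) (hf' : f + 1 ∉ B) : e = f := by
  classical
  have h1 : (B.filter (fun p => p - 1 ∉ B)).card ≤ 1 := by
    rw [Finset.card_le_one]
    intro p hp q hq
    simp only [Finset.mem_filter] at hp hq
    exact hB p hp.1 q hq.1 hp.2 hq.2
  have h2 := Finset.card_filter_add_card_filter_not (s := B) (fun p => p - 1 ∈ B)
  have h3 := Finset.card_filter_add_card_filter_not (s := B) (fun p => p + 1 ∈ B)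
  have h4 : (B.filter (fun p => p - 1 ∈ B)).card = (B.filter (fun p => p + 1 ∈ B)).card := by
    apply Finset.card_bij (fun p _ => p - 1)
    · intro p hp
      simp only [Finset.mem_filter] at hp ⊢
      exact ⟨hp.2, by simpa using hp.1⟩
    · intro p _ q _ h
      simpa using h
    · intro p hp
      simp only [Finset.mem_filter] at hp
      exact ⟨p + 1, by simp [hp.1, hp.2], by simp⟩
  have h5 : (B.filter (fun p => p + 1 ∉ B)).card ≤ 1 := by omega
  rw [Finset.card_le_one] at h5
  exact h5 e (by simp [he, he']) f (by simp [hf, hf'])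

lemma natCast_ne_zero_of_lt {j : ℕ} (h0 : 0 < j) (hj : j < k) : (j : ZMod k) ≠ 0 := by
  rw [Ne, ZMod.natCast_eq_zero_iff]
  exact Nat.not_dvd_of_pos_of_lt h0 hj

lemma two_mul_le_of_natCast_add_eq_zero {d j : ℕ} (hd : k ≤ d) (h0 : 0 < j)
    (h : (d : ZMod k) + j = 0) : 2 * k ≤ d + j := by
  have h' : ((d + j : ℕ) : ZMod k) = 0 := by push_cast; exact h
  rw [ZMod.natCast_eq_zero_iff] at h'
  obtain ⟨q, hq⟩ := h'
  have : 2 ≤ q := by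
    by_contra hlt
    have : q ≤ 1 := by omega
    have : k * q ≤ k * 1 := Nat.mul_le_mul_left k this
    omega
  nlinarith

/-- The smallest potential of a set of `m ≥ 3` residues. -/
def potBase (k m : ℕ) : ℕ := 4 * k - 1 + (5 * k - 4) * (m - 3)

lemma potBase_succ {k m : ℕ} (hm : 3 ≤ m) : potBase k (m + 1) = potBase k m + (5 * k - 4) := by
  obtain ⟨j, rfl⟩ := Nat.exists_eq_add_of_le hm
  have : 3 + j + 1 - 3 = j + 1 := by omega
  simp only [potBase, this, Nat.add_sub_cancel_left]
  ring

lemma potBase_mono {k m m' : ℕ} (h : m ≤ m') : potBase k m ≤ potBase k m' :=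
  Nat.add_le_add_left (Nat.mul_le_mul_left _ (by omega)) _

open Classical in
/-- The potential of a set `B` of forbidden residues at an occurrence in residue class `r`,
with parameters for singletons and for sets with at least three elements. -/
noncomputable def pot (single offset : ℕ) (B : Finset (ZMod k)) (r : ZMod k) : ℕ :=
  if B.card = 0 then 1
  else if B.card = 1 then single
  else if B.card = 2 then if IsArcTo B r then 2 * k else 2 * k + 2
  else if B.card = k then potBase k (k - 1) + (2 * k - 1)
  else potBase k B.card + offset

open Classical in
/-- The potential at an occurrence of `u`. -/
noncomputable def potU (B : Finset (ZMod k)) (r : ZMod k) : ℕ :=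
  pot (k + 2)
    (if IsArcTo B r then 0 else if r ∉ B ∧ IsArc B then 4 * k - 4 else 2 * k - 1) B r

open Classical in
/-- The potential at an occurrence of `v`. -/
noncomputable def potV (B : Finset (ZMod k)) (r : ZMod k) : ℕ :=
  pot 1
    (if ¬ IsArc B ∨ B.card = k - 1 then k - 2
      else if IsArcTo B r then 3 * k - 3 else 4 * k - 4) B r

lemma pot_le_of_card_lt {single offset single' offset' : ℕ} {A B : Finset (ZMod k)}
    {r r' : ZMod k} (hk : 4 ≤ k) (hs : single ≤ k + 2) (ho : offset ≤ 4 * k - 4)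
    (hs' : 1 ≤ single') (h : A.card < B.card) (hB : B.card < k) :
    pot single offset A r ≤ pot single' offset' B r' := by
  have h3 : potBase k 3 = 4 * k - 1 := by simp [potBase]
  have hA := @potBase_succ k A.card
  have hBm : 3 ≤ B.card → potBase k 3 ≤ potBase k B.card := potBase_mono
  have hAB : potBase k (A.card + 1) ≤ potBase k B.card := potBase_mono h
  unfold pot
  split_ifs <;> omega

lemma card_lt_of_ne_univ {B : Finset (ZMod k)} (hB : B ≠ Finset.univ) : B.card < k := by
  simpa using Finset.card_lt_univ_of_notMem (not_forall.1 (mt Finset.eq_univ_iff_forall.2 hB)).choose_spec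

lemma eq_insert_of_card_eq_add_one {A B C : Finset (ZMod k)} {s : ZMod k}
    (hA : A ⊆ insert s C) (hC : C ⊆ B) (h : A.card = B.card + 1) :
    C = B ∧ s ∉ B ∧ A = insert s B := by
  have h1 := Finset.card_le_card hA
  have h2 := Finset.card_le_card hC
  have h3 := Finset.card_insert_le s C
  have hCB : C = B := Finset.eq_of_subset_of_card_le hC (by omega)
  subst hCB
  refine ⟨rfl, fun hs => ?_, Finset.eq_of_subset_of_card_le hA (by omega)⟩
  rw [Finset.insert_eq_of_mem hs] at h1
  omega

lemma eq_of_card_eq_of_notMem {A B C : Finset (ZMod k)} {s : ZMod k}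
    (hA : A ⊆ insert s C) (hC : C ⊆ B) (h : A.card = B.card) (hs : s ∈ B ∨ s ∉ A) :
    A = B := by
  apply Finset.eq_of_subset_of_card_le _ h.ge
  intro r hr
  have := hA hr
  rw [Finset.mem_insert] at this
  rcases this with rfl | h'
  · exact hs.resolve_right (not_not.2 hr)
  · exact hC h'

lemma eq_erase_of_card_eq {A B C : Finset (ZMod k)} {s p : ZMod k}
    (hA : A ⊆ insert s C) (hC : C ⊆ B) (h : A.card = B.card) (hp : p ∈ B) (hpC : p ∉ C) :
    s ∉ C ∧ C = B.erase p ∧ A = insert s C := by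
  have h1 := Finset.card_le_card hA
  have h3 := Finset.card_insert_le s C
  have hC' : C ⊆ B.erase p := fun r hr =>
    Finset.mem_erase.2 ⟨fun h' => hpC (h' ▸ hr), hC hr⟩
  have h4 := Finset.card_le_card hC'
  have h5 := Finset.card_erase_add_one hp
  refine ⟨fun hs => ?_, Finset.eq_of_subset_of_card_le hC' (by omega),
    Finset.eq_of_subset_of_card_le hA (by omega)⟩
  rw [Finset.insert_eq_of_mem hs] at h1
  omega

lemma subset_insert_of_mem_iff {A C : Finset (ZMod k)} {s : ZMod k}
    (hA : ∀ r, r ≠ s → (r ∈ A ↔ r ∈ C)) : A ⊆ insert s C := fun r hr => by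
  by_cases hrs : r = s
  · simp [hrs]
  · exact Finset.mem_insert_of_mem ((hA r hrs).1 hr)

lemma card_le_add_one {A B C : Finset (ZMod k)} {s : ZMod k}
    (hA : A ⊆ insert s C) (hC : C ⊆ B) : A.card ≤ B.card + 1 :=
  (Finset.card_le_card hA).trans ((Finset.card_insert_le s C).trans
    (Nat.add_le_add_right (Finset.card_le_card hC) 1))

lemma IsArc.insert_succ {B : Finset (ZMod k)} {s : ZMod k} (hB : IsArc B)
    (hp : s - 1 ∈ B) : IsArc (insert s B) := by
  intro p hp1 q hq1 hp2 hq2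
  rw [Finset.mem_insert] at hp1 hq1
  simp only [Finset.mem_insert, not_or] at hp2 hq2
  rcases hp1 with rfl | hp1
  · exact absurd hp hp2.2
  rcases hq1 with rfl | hq1
  · exact absurd hp hq2.2
  exact hB p hp1 q hq1 hp2.2 hq2.2

lemma IsArc.isArcTo_insert {B : Finset (ZMod k)} {s : ZMod k} (hB : IsArc B) (hk : 4 ≤ k)
    (hp : s - 1 ∈ B) (hn : s + 1 ∉ B) : IsArcTo (insert s B) s := by
  refine ⟨hB.insert_succ hp, Finset.mem_insert_self _ _, ?_⟩
  have h1 := natCast_ne_zero_of_lt (k := k) (j := 1) (by omega) (by omega)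
  simpa [hn] using h1

lemma pot_of_card_eq_zero {single offset : ℕ} {B : Finset (ZMod k)} {r : ZMod k}
    (h : B.card = 0) : pot single offset B r = 1 := by
  rw [pot, if_pos h]

lemma pot_of_card_eq_one {single offset : ℕ} {B : Finset (ZMod k)} {r : ZMod k}
    (h : B.card = 1) : pot single offset B r = single := by
  rw [pot, if_neg (by omega), if_pos h]

open Classical in
lemma pot_of_card_eq_two {single offset : ℕ} {B : Finset (ZMod k)} {r : ZMod k}
    (h : B.card = 2) : pot single offset B r = if IsArcTo B r then 2 * k else 2 * k + 2 := by
  rw [pot, if_neg (by omega), if_neg (by omega), if_pos h]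

lemma pot_of_three_le_card {single offset : ℕ} {B : Finset (ZMod k)} {r : ZMod k}
    (h : 3 ≤ B.card) (hk : B.card < k) :
    pot single offset B r = potBase k B.card + offset := by
  rw [pot, if_neg (by omega), if_neg (by omega), if_neg (by omega), if_neg (by omega)]

lemma pot_of_card_eq {single offset : ℕ} {B : Finset (ZMod k)} {r : ZMod k}
    (h : B.card = k) (hk : 4 ≤ k) :
    pot single offset B r = potBase k (k - 1) + (2 * k - 1) := by
  rw [pot, if_neg (by omega), if_neg (by omega), if_neg (by omega), if_pos h]

lemma potBase_three {k : ℕ} : potBase k 3 = 4 * k - 1 := by simp [potBase]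

lemma potU_le_potU_add {A B C : Finset (ZMod k)} {s t : ZMod k} {d : ℕ} (hk : 4 ≤ k)
    (hd : k ≤ d) (ht : s + d = t) (hC : C ⊆ B) (hB : B ≠ Finset.univ)
    (lost : ∀ p ∈ B, p - 1 ∉ B → p ≠ t → p ≠ t + 1 → p ∉ C) (htB : t ∈ B ↔ t - 1 ∈ B)
    (hA : ∀ r, r ≠ s → (r ∈ A ↔ r ∈ C)) (hs : s ∈ A ↔ s - 1 ∈ C) :
    potU A s ≤ potU B t + d := by
  have h1 := natCast_ne_zero_of_lt (k := k) (j := 1) (by omega) (by omega)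
  rw [Nat.cast_one] at h1
  have hss : s + 1 ≠ s := by simpa using h1
  have hAC := subset_insert_of_mem_iff hA
  have hBk := card_lt_of_ne_univ hB
  have hle := card_le_add_one hAC hC
  rcases lt_or_ge A.card B.card with hlt | hge
  · refine (pot_le_of_card_lt hk le_rfl ?_ ?_ hlt hBk).trans (Nat.le_add_right _ _)
    · split_ifs <;> omega
    · omega
  rcases hge.eq_or_lt with heq | hgt
  · have h2 : 3 ≤ B.card → IsArcTo B t → IsArcTo A s := by
      intro h3 ⟨hBa, htB', htB1⟩
      obtain ⟨p, hp, hp'⟩ := exists_start (Finset.card_pos.1 (by omega)) hB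
      have hpt : p ≠ t := by rintro rfl; exact hp' (htB.1 hp)
      have hpt1 : p ≠ t + 1 := by rintro rfl; exact htB1 hp
      have hpC := lost p hp hp' hpt hpt1
      have hps : p ≠ s := by
        rintro rfl
        have hAB := eq_of_card_eq_of_notMem hAC hC heq.symm (Or.inl hp)
        exact hp' (hC (hs.1 (hAB ▸ hp)))
      obtain ⟨hsC, hCe, hAe⟩ := eq_erase_of_card_eq hAC hC heq.symm hp hpC
      have hsA : s ∈ A := hAe ▸ Finset.mem_insert_self _ _
      have hsB : s ∉ B := fun h => hsC (hCe ▸ Finset.mem_erase.2 ⟨hps.symm, h⟩)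
      have hs1 : s + 1 ∉ A := fun h => by
        have h' := (hA _ hss).1 h
        have := hBa _ (hC h') p hp (by simpa using hsB) hp'
        exact hpC (this ▸ h')
      refine ⟨?_, hsA, hs1⟩
      have key : ∀ q ∈ A, q - 1 ∉ A → q = p + 1 := by
        intro q hq hq'
        have hqs : q ≠ s := by
          rintro rfl
          apply hq'
          rw [hAe]
          exact Finset.mem_insert_of_mem (hs.1 hq)
        have hqC := (hA q hqs).1 hq
        have hqp : q ≠ p := by rintro rfl; exact hpC hqC
        have hq1 : q - 1 ∈ B := by
          by_contra h
          exact hqp (hBa q (hC hqC) p hp h hp')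
        by_contra hne
        apply hq'
        rw [hAe, hCe]
        refine Finset.mem_insert_of_mem (Finset.mem_erase.2 ⟨?_, hq1⟩)
        rintro h
        exact hne (by rw [← h]; ring)
      intro q hq q' hq' h h'
      rw [key q hq h, key q' hq' h']
    have h4 : 3 ≤ B.card → s ∉ A → IsArc A → t ∉ B ∧ IsArc B := by
      intro h3 hsA hAa
      have hAB := eq_of_card_eq_of_notMem hAC hC heq.symm (Or.inr hsA)
      rw [hAB] at hAa
      refine ⟨fun htB' => ?_, hAa⟩
      obtain ⟨p, hp, hp'⟩ := exists_start (Finset.card_pos.1 (by omega)) hB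
      have hps : p ≠ s := by rintro rfl; exact hsA (hAB ▸ hp)
      refine lost p hp hp' ?_ ?_ ((hA p hps).1 (hAB ▸ hp))
      · rintro rfl; exact hp' (htB.1 hp)
      · rintro rfl; apply hp'; simpa using htB'
    unfold potU
    rcases (by omega : B.card = 0 ∨ B.card = 1 ∨ B.card = 2 ∨ 3 ≤ B.card) with h | h | h | h
    · rw [pot_of_card_eq_zero h, pot_of_card_eq_zero (by omega)]
      omega
    · rw [pot_of_card_eq_one h, pot_of_card_eq_one (by omega)]
      omega
    · rw [pot_of_card_eq_two h, pot_of_card_eq_two (by omega)]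
      split_ifs <;> omega
    · rw [pot_of_three_le_card h hBk, pot_of_three_le_card (by omega) (by omega), ← heq]
      specialize h2 h
      specialize h4 h
      split_ifs <;> first | omega | (exfalso; tauto)
  · obtain ⟨hCB, hsB, hAe⟩ := eq_insert_of_card_eq_add_one hAC hC (by omega)
    subst hCB
    have hs1 : s - 1 ∈ C := hs.1 (hAe ▸ Finset.mem_insert_self _ _)
    have hst : ∀ p ∈ C, p - 1 ∉ C → p = t + 1 := by
      intro p hp hp'
      by_contra h
      refine lost p hp hp' ?_ h hp
      rintro rfl
      exact hp' (htB.1 hp)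
    have hCa : IsArc C := fun p hp q hq hp' hq' => by rw [hst p hp hp', hst q hq hq']
    obtain ⟨p, hp, hp'⟩ := exists_start ⟨_, hs1⟩ hB
    have hpt := hst p hp hp'
    have htC : t ∉ C := by simpa [hpt] using hp'
    have hs2 : s + 1 ∉ C := fun h => by
      have := hst _ h (by simpa using hsB)
      rw [add_left_inj] at this
      subst this
      exact htC (htB.2 hs1)
    have hAt : IsArcTo A s := hAe ▸ hCa.isArcTo_insert hk hs1 hs2
    have hAk : A.card < k := card_lt_of_ne_univ fun h => hAt.2.2 (h ▸ Finset.mem_univ _)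
    have hC0 : 0 < C.card := Finset.card_pos.2 ⟨_, hs1⟩
    have hA1 : A.card = C.card + 1 := by omega
    have hCt : ¬ IsArcTo C t := fun h => htC h.2.1
    have hd2 : C.card = 2 → 2 * k ≤ d + 3 := by
      intro h2
      have hp1 : p + 1 ∈ C := by
        by_contra h
        rw [hCa.eq_singleton hp hp' h] at h2
        simp at h2
      have hpp : p ≠ p + 1 := by simpa using h1
      have hCe : C = {p, p + 1} := by
        symm
        apply Finset.eq_of_subset_of_card_le
        · intro r hr
          simp only [Finset.mem_insert, Finset.mem_singleton] at hr
          rcases hr with rfl | rfl <;> assumption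
        · rw [h2, Finset.card_pair hpp]
      have hs3 := hs1
      rw [hCe] at hs3
      simp only [Finset.mem_insert, Finset.mem_singleton] at hs3
      rcases hs3 with h | h
      · exact absurd (sub_eq_iff_eq_add.1 h ▸ hp1) hsB
      · refine two_mul_le_of_natCast_add_eq_zero hd (by omega) ?_
        have : s = t + 3 := by linear_combination h + hpt
        push_cast
        linear_combination ht - this
    have hb := @potBase_succ k C.card
    unfold potU
    rcases (by omega : C.card = 1 ∨ C.card = 2 ∨ 3 ≤ C.card) with h | h | h
    · rw [pot_of_card_eq_two (by omega), pot_of_card_eq_one h, if_pos hAt]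
      omega
    · rw [pot_of_three_le_card (by omega) hAk, pot_of_card_eq_two h, if_neg hCt, if_pos hAt,
        hA1, h, potBase_three]
      have := hd2 h
      omega
    · rw [pot_of_three_le_card (by omega) hAk, pot_of_three_le_card h hBk, if_neg hCt,
        if_pos hAt, if_pos ⟨htC, hCa⟩, hA1, hb h]
      omega

lemma potU_le_potV_add {A B C : Finset (ZMod k)} {s t h : ZMod k} {d : ℕ} (hk : 4 ≤ k)
    (hd : k ≤ d) (ht : s + d = t) (hC : C ⊆ B) (hB : B ≠ Finset.univ)
    (lost : ∀ p ∈ B, p - 1 ∉ B → p ≠ h → p ≠ h + 1 → p ∉ C) (hh : d = k → h = t)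
    (htB : t ∈ B) (hA : ∀ r, r ≠ s → (r ∈ A ↔ r ∈ C)) (hs : s ∈ A ↔ s - 1 ∈ C) :
    potU A s ≤ potV B t + d := by
  have h1 := natCast_ne_zero_of_lt (k := k) (j := 1) (by omega) (by omega)
  rw [Nat.cast_one] at h1
  have hAC := subset_insert_of_mem_iff hA
  have hBk := card_lt_of_ne_univ hB
  have hle := card_le_add_one hAC hC
  have hB0 : 0 < B.card := Finset.card_pos.2 ⟨t, htB⟩
  have hdk : d = k → s = t := by
    rintro rfl
    simpa using ht
  obtain ⟨p, hp, hp'⟩ := exists_start ⟨t, htB⟩ hB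
  rcases lt_or_ge A.card B.card with hlt | hge
  · refine (pot_le_of_card_lt hk le_rfl ?_ le_rfl hlt hBk).trans (Nat.le_add_right _ _)
    split_ifs <;> omega
  rcases hge.eq_or_lt with heq | hgt
  · have hd' : k + 1 ≤ d := by
      by_contra hlt
      have hdk' : d = k := by omega
      have hst := hdk hdk'
      have hht := hh hdk'
      subst hst hht
      have hAB := eq_of_card_eq_of_notMem hAC hC heq.symm (Or.inl htB)
      by_cases hps : p = h
      · subst hps
        exact hp' (hC (hs.1 (hAB ▸ hp)))
      · refine lost p hp hp' hps ?_ ((hA p hps).1 (hAB ▸ hp))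
        rintro rfl
        apply hp'
        simpa using htB
    have h4 : s ∉ A → IsArc A → IsArc B ∧ B.card ≠ k - 1 := by
      intro hsA hAa
      have hAB := eq_of_card_eq_of_notMem hAC hC heq.symm (Or.inr hsA)
      refine ⟨hAB ▸ hAa, fun hc => ?_⟩
      have hs1 : s - 1 ∉ A := fun h => hsA (hs.2 ((hA _ (by simpa using h1)).1 h))
      have hs2 : s - 1 ∉ insert s A := by
        rw [Finset.mem_insert]
        rintro (h | h)
        · exact h1 (by simpa using h)
        · exact hs1 h
      have hc1 := Finset.card_insert_of_notMem hsA
      have hc2 := Finset.card_insert_of_notMem hs2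
      have hc3 := Finset.card_le_univ (insert (s - 1) (insert s A))
      rw [ZMod.card] at hc3
      omega
    unfold potU potV
    rcases (by omega : B.card = 1 ∨ B.card = 2 ∨ 3 ≤ B.card) with h | h | h
    · rw [pot_of_card_eq_one h, pot_of_card_eq_one (by omega)]
      omega
    · rw [pot_of_card_eq_two h, pot_of_card_eq_two (by omega)]
      split_ifs <;> omega
    · rw [pot_of_three_le_card h hBk, pot_of_three_le_card (by omega) (by omega), ← heq]
      split_ifs <;> first | omega | (exfalso; tauto)
  · obtain ⟨hCB, hsB, hAe⟩ := eq_insert_of_card_eq_add_one hAC hC (by omega)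
    subst hCB
    have hs1 : s - 1 ∈ C := hs.1 (hAe ▸ Finset.mem_insert_self _ _)
    have hd' : k + 1 ≤ d := by
      by_contra hlt
      exact hsB (hdk (by omega) ▸ htB)
    have hst : ∀ p ∈ C, p - 1 ∉ C → p = h ∨ p = h + 1 := by
      intro p hp hp'
      by_contra hn
      rw [not_or] at hn
      exact lost p hp hp' hn.1 hn.2 hp
    have hCa : IsArc C := by
      intro p hp q hq hp' hq'
      rcases hst p hp hp' with rfl | rfl <;> rcases hst q hq hq' with rfl | rfl
      · rfl
      · exact absurd hp (by simpa using hq')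
      · exact absurd hq (by simpa using hp')
      · rfl
    have hb := @potBase_succ k C.card
    have hA1 : A.card = C.card + 1 := by omega
    by_cases hs2 : s + 1 ∈ C
    · have hc := hCa.card_add_one hs2 (by simpa using hsB) (by simpa using hs1)
      have hc' : C.card = k - 1 := by omega
      unfold potU potV
      rw [pot_of_card_eq (by omega) hk, pot_of_three_le_card (by omega) hBk, if_pos (Or.inr hc'),
        hc']
      omega
    have hAt : IsArcTo A s := hAe ▸ hCa.isArcTo_insert hk hs1 hs2
    have hAk : A.card < k := card_lt_of_ne_univ fun h => hAt.2.2 (h ▸ Finset.mem_univ _)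
    have hCt : s = t + 1 → 2 * k ≤ d + 1 := by
      intro h
      refine two_mul_le_of_natCast_add_eq_zero (by omega) (by omega) ?_
      push_cast
      linear_combination ht - h
    have hCt' : IsArcTo C t → s = t + 1 := fun h =>
      sub_eq_iff_eq_add.1 (hCa.end_unique hs1 h.2.1 (by simpa using hsB) h.2.2)
    unfold potU potV
    rcases (by omega : C.card = 1 ∨ C.card = 2 ∨ 3 ≤ C.card) with h | h | h
    · rw [pot_of_card_eq_two (by omega), pot_of_card_eq_one h, if_pos hAt]
      have := hCt (sub_eq_iff_eq_add.1 (Finset.card_le_one.1 h.le _ hs1 _ htB))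
      omega
    · rw [pot_of_three_le_card (by omega) hAk, pot_of_card_eq_two h, if_pos hAt,
        hA1, h, potBase_three]
      by_cases hCT : IsArcTo C t
      · rw [if_pos hCT]
        have := hCt (hCt' hCT)
        omega
      · rw [if_neg hCT]
        have ht1 : t + 1 ∈ C := by
          by_contra hn
          exact hCT ⟨hCa, htB, hn⟩
        have htt : t ≠ t + 1 := by simpa using h1
        have hCe : C = {t, t + 1} := by
          symm
          apply Finset.eq_of_subset_of_card_le
          · intro r hr
            simp only [Finset.mem_insert, Finset.mem_singleton] at hr
            rcases hr with rfl | rfl <;> assumption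
          · rw [h, Finset.card_pair htt]
        have hs3 := hs1
        rw [hCe] at hs3
        simp only [Finset.mem_insert, Finset.mem_singleton] at hs3
        rcases hs3 with hr | hr
        · exact absurd (sub_eq_iff_eq_add.1 hr ▸ ht1) hsB
        · have : 2 * k ≤ d + 2 := by
            refine two_mul_le_of_natCast_add_eq_zero (by omega) (by omega) ?_
            push_cast
            linear_combination ht - hr
          omega
    · rw [pot_of_three_le_card (by omega) hAk, pot_of_three_le_card h hBk, if_pos hAt,
        hA1, hb h, if_neg (not_or.2 ⟨not_not.2 hCa, by omega⟩)]
      by_cases hCT : IsArcTo C t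
      · rw [if_pos hCT]
        have := hCt (hCt' hCT)
        omega
      · rw [if_neg hCT]
        omega

lemma potV_le_potV_add {A B C : Finset (ZMod k)} {s t : ZMod k} {d : ℕ} (hk : 4 ≤ k)
    (hd : k ≤ d) (hC : C ⊆ B) (hB : B ≠ Finset.univ)
    (lost : ∀ p ∈ B, p - 1 ∉ B → p ≠ s → p ∉ C)
    (htB : t ∈ B) (hA : ∀ r, r ≠ s → (r ∈ A ↔ r ∈ C)) :
    potV A s ≤ potV B t + d := by
  have hAC := subset_insert_of_mem_iff hA
  have hBk := card_lt_of_ne_univ hB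
  have hle := card_le_add_one hAC hC
  have hB0 : 0 < B.card := Finset.card_pos.2 ⟨t, htB⟩
  rcases lt_or_ge A.card B.card with hlt | hge
  · refine (pot_le_of_card_lt hk (by omega) ?_ le_rfl hlt hBk).trans (Nat.le_add_right _ _)
    split_ifs <;> omega
  rcases hge.eq_or_lt with heq | hgt
  · have hBa : IsArc B := by
      have aux : ∀ p ∈ B, ∀ q ∈ B, p - 1 ∉ B → q - 1 ∉ B → p ≠ s → p = q := by
        intro p hp q hq hp' hq' hps
        by_contra hpq
        have hpC := lost p hp hp' hps
        obtain ⟨hsC, hCe, hAe⟩ := eq_erase_of_card_eq hAC hC heq.symm hp hpC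
        have hqC : q ∈ C := hCe ▸ Finset.mem_erase.2 ⟨Ne.symm hpq, hq⟩
        refine lost q hq hq' ?_ hqC
        rintro rfl
        exact hsC hqC
      intro p hp q hq hp' hq'
      by_cases hps : p = s
      · by_cases hqs : q = s
        · rw [hps, hqs]
        · exact (aux q hq p hp hq' hp' hqs).symm
      · exact aux p hp q hq hp' hq' hps
    unfold potV
    rcases (by omega : B.card = 1 ∨ B.card = 2 ∨ 3 ≤ B.card) with h | h | h
    · rw [pot_of_card_eq_one h, pot_of_card_eq_one (by omega)]
      omega
    · rw [pot_of_card_eq_two h, pot_of_card_eq_two (by omega)]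
      split_ifs <;> omega
    · rw [pot_of_three_le_card h hBk, pot_of_three_le_card (by omega) (by omega), ← heq]
      split_ifs <;> first | omega | (exfalso; tauto)
  · obtain ⟨hCB, hsB, hAe⟩ := eq_insert_of_card_eq_add_one hAC hC (by omega)
    subst hCB
    obtain ⟨p, hp, hp'⟩ := exists_start ⟨t, htB⟩ hB
    exact absurd hp (lost p hp hp' (by rintro rfl; exact hsB hp))

lemma potV_le_potU_add {A B C : Finset (ZMod k)} {s t : ZMod k} {d : ℕ} (hk : 4 ≤ k)
    (hd : k ≤ d) (ht : s + d = t) (hC : C ⊆ B) (hB : B ≠ Finset.univ)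
    (lost : ∀ p ∈ B, p - 1 ∉ B → p ≠ t → p ∉ C) (hs1 : s + 1 ∈ C → s ∈ C)
    (lost' : 2 * k ≤ d + 1 → ∀ p ∈ B, p - 1 ∉ B → p ≠ t → p + 1 ∉ C)
    (htB : t ∈ B ↔ t - 1 ∈ B) (hA : ∀ r, r ≠ s → (r ∈ A ↔ r ∈ C)) (hs : s ∈ A) :
    potV A s ≤ potU B t + d := by
  have h1 := natCast_ne_zero_of_lt (k := k) (j := 1) (by omega) (by omega)
  rw [Nat.cast_one] at h1
  have hAC := subset_insert_of_mem_iff hA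
  have hBk := card_lt_of_ne_univ hB
  have hle := card_le_add_one hAC hC
  have hnt : ∀ p ∈ B, p - 1 ∉ B → p ≠ t := by
    rintro p hp hp' rfl
    exact hp' (htB.1 hp)
  replace lost : ∀ p ∈ B, p - 1 ∉ B → p ∉ C := fun p hp hp' => lost p hp hp' (hnt p hp hp')
  rcases lt_or_ge A.card B.card with hlt | hge
  · refine (pot_le_of_card_lt hk (by omega) ?_ (by omega) hlt hBk).trans (Nat.le_add_right _ _)
    split_ifs <;> omega
  rcases hge.eq_or_lt with heq | hgt
  · have h2 : 3 ≤ B.card → IsArc A → IsArcTo A s ∧ ¬ IsArcTo B t := by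
      intro h3 hAa
      obtain ⟨p, hp, hp'⟩ := exists_start (Finset.card_pos.1 (by omega)) hB
      obtain ⟨hsC, hCe, hAe⟩ := eq_erase_of_card_eq hAC hC heq.symm hp (lost p hp hp')
      have hsA : s + 1 ∉ A := fun h => hsC (hs1 ((hA _ (by simpa using h1)).1 h))
      refine ⟨⟨hAa, hs, hsA⟩, fun ⟨hBa, htB', ht1⟩ => ?_⟩
      have htC : t ∈ C := hCe ▸ Finset.mem_erase.2 ⟨(hnt p hp hp').symm, htB'⟩
      have htA : t ∈ A := hAe ▸ Finset.mem_insert_of_mem htC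
      have hst : s = t + 1 := by
        by_contra hne
        have ht1' : t + 1 ∉ A := fun h => ht1 (hC ((hA _ (Ne.symm hne)).1 h))
        exact hsC (hAa.end_unique hs htA hsA ht1' ▸ htC)
      have hd2 : 2 * k ≤ d + 1 := by
        refine two_mul_le_of_natCast_add_eq_zero (by omega) (by omega) ?_
        push_cast
        linear_combination ht - hst
      have hp1 : p + 1 ∈ B := by
        by_contra hn
        rw [hBa.eq_singleton hp hp' hn] at h3
        simp at h3
      exact lost' hd2 p hp hp' (hnt p hp hp')
        (hCe ▸ Finset.mem_erase.2 ⟨by simpa using h1, hp1⟩)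
    unfold potU potV
    rcases (by omega : B.card = 0 ∨ B.card = 1 ∨ B.card = 2 ∨ 3 ≤ B.card) with h | h | h | h
    · rw [pot_of_card_eq_zero h, pot_of_card_eq_zero (by omega)]
      omega
    · rw [pot_of_card_eq_one h, pot_of_card_eq_one (by omega)]
      omega
    · rw [pot_of_card_eq_two h, pot_of_card_eq_two (by omega)]
      split_ifs <;> omega
    · rw [pot_of_three_le_card h hBk, pot_of_three_le_card (by omega) (by omega), ← heq]
      specialize h2 h
      split_ifs <;> first | omega | (exfalso; tauto)
  · obtain ⟨hCB, hsB, hAe⟩ := eq_insert_of_card_eq_add_one hAC hC (by omega)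
    subst hCB
    have hC0 : C.card = 0 := by
      by_contra hne
      obtain ⟨p, hp, hp'⟩ := exists_start (Finset.card_pos.1 (by omega)) hB
      exact lost p hp hp' hp
    unfold potU potV
    rw [pot_of_card_eq_zero hC0, pot_of_card_eq_one (by omega)]
    omega

lemma potV_le_potU_add_of_overlap {A B C : Finset (ZMod k)} {s t : ZMod k} (hk : 4 ≤ k)
    (ht : s = t + 2) (hC : C ⊆ B) (hB : B ≠ Finset.univ)
    (lost : ∀ p ∈ B, p - 1 ∉ B → p ≠ t → p ≠ t + 1 → p ≠ s → p ∉ C)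
    (hs1 : s + 1 ∈ C → s ∈ B)
    (htB : t ∈ B ↔ t - 1 ∈ B) (hA : ∀ r, r ≠ s → (r ∈ A ↔ r ∈ C)) (hs : s ∈ A) :
    potV A s ≤ potU B t + (k - 2) := by
  have h1 := natCast_ne_zero_of_lt (k := k) (j := 1) (by omega) (by omega)
  rw [Nat.cast_one] at h1
  have hAC := subset_insert_of_mem_iff hA
  have hBk := card_lt_of_ne_univ hB
  have hle := card_le_add_one hAC hC
  have hts : t + 1 ≠ s := by
    rw [ht]
    intro h
    exact h1 (by linear_combination -h)
  have hs2 : s - 1 = t + 1 := by rw [ht]; ring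
  have hs3 : s - 1 - 1 = t := by rw [ht]; ring
  have hnt : ∀ p ∈ B, p - 1 ∉ B → p ≠ t := by
    rintro p hp hp' rfl
    exact hp' (htB.1 hp)
  replace lost : ∀ p ∈ B, p - 1 ∉ B → p ≠ t + 1 → p ≠ s → p ∉ C :=
    fun p hp hp' => lost p hp hp' (hnt p hp hp')
  rcases lt_or_ge A.card B.card with hlt | hge
  · refine (pot_le_of_card_lt hk (by omega) ?_ (by omega) hlt hBk).trans (Nat.le_add_right _ _)
    split_ifs <;> omega
  rcases hge.eq_or_lt with heq | hgt
  · have h2 : 3 ≤ B.card → IsArcTo B t → ¬ IsArc A ∨ B.card = k - 1 := by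
      rintro h3 ⟨hBa, htB', ht1⟩
      by_contra! hn
      obtain ⟨hAa, hBk1⟩ := hn
      by_cases hsB : s ∈ B
      · have := hBa.card_add_one hsB (hs2 ▸ ht1) (hs3 ▸ htB')
        omega
      obtain ⟨p, hp, hp'⟩ := exists_start (Finset.card_pos.1 (by omega)) hB
      obtain ⟨hsC, hCe, hAe⟩ := eq_erase_of_card_eq hAC hC heq.symm hp
        (lost p hp hp' (by rintro rfl; exact ht1 hp) (by rintro rfl; exact hsB hp))
      have htC : t ∈ C := hCe ▸ Finset.mem_erase.2 ⟨(hnt p hp hp').symm, htB'⟩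
      have htA : t ∈ A := hAe ▸ Finset.mem_insert_of_mem htC
      have ht1' : t + 1 ∉ A := fun h => ht1 (hC ((hA _ hts).1 h))
      have := hAa.card_add_one hs (hs2 ▸ ht1') (hs3 ▸ htA)
      omega
    have h3 : 3 ≤ B.card → IsArc A → ¬ IsArcTo A s → B.card ≠ k - 1 → t ∉ B ∧ IsArc B := by
      intro h3 hAa hAt hBk1
      have hsB : s ∈ B := by
        apply hs1
        rw [← hA _ (by simpa using h1)]
        by_contra hn
        exact hAt ⟨hAa, hs, hn⟩
      have hAB := eq_of_card_eq_of_notMem hAC hC heq.symm (Or.inl hsB)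
      subst hAB
      refine ⟨fun htA => ?_, hAa⟩
      obtain ⟨p, hp, hp'⟩ := exists_start (Finset.card_pos.1 (by omega)) hB
      by_cases hps : p = s
      · subst hps
        have := hAa.card_add_one hp hp' (hs3 ▸ htA)
        omega
      · refine lost p hp hp' ?_ hps ((hA p hps).1 hp)
        rintro rfl
        apply hp'
        simpa using htA
    unfold potU potV
    rcases (by omega : B.card = 0 ∨ B.card = 1 ∨ B.card = 2 ∨ 3 ≤ B.card) with h | h | h | h
    · rw [pot_of_card_eq_zero h, pot_of_card_eq_zero (by omega)]
      omega
    · rw [pot_of_card_eq_one h, pot_of_card_eq_one (by omega)]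
      omega
    · rw [pot_of_card_eq_two h, pot_of_card_eq_two (by omega)]
      split_ifs <;> omega
    · rw [pot_of_three_le_card h hBk, pot_of_three_le_card (by omega) (by omega), ← heq]
      specialize h2 h
      specialize h3 h
      split_ifs <;> first | omega | (exfalso; tauto)
  · obtain ⟨hCB, hsB, hAe⟩ := eq_insert_of_card_eq_add_one hAC hC (by omega)
    subst hCB
    unfold potU potV
    by_cases hC0 : C.card = 0
    · rw [pot_of_card_eq_zero hC0, pot_of_card_eq_one (by omega)]
      omega
    obtain ⟨p, hp, hp'⟩ := exists_start (Finset.card_pos.1 (by omega)) hB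
    have hst : ∀ q ∈ C, q - 1 ∉ C → q = s - 1 := by
      intro q hq hq'
      by_contra hn
      exact lost q hq hq' (hs2 ▸ hn) (by rintro rfl; exact hsB hq) hq
    have hCa : IsArc C := fun p hp q hq hp' hq' => by rw [hst p hp hp', hst q hq hq']
    have hps := hst p hp hp'
    have hC1 : C.card = 1 := by
      rw [hCa.eq_singleton hp hp' (by simpa [hps] using hsB), Finset.card_singleton]
    rw [pot_of_card_eq_one hC1, pot_of_card_eq_two (by omega),
      if_pos (hAe ▸ hCa.isArcTo_insert hk (hps ▸ hp) fun h => hsB (hs1 h))]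
    omega

end Cyclic

section Dynamics

variable {k n : ℕ} {x : ℕ → Bool} {D : ℕ → Prop}

/-- The factor of length `k - 1` of `x` at position `j` is a power of the letter `c`. -/
def IsRun (k : ℕ) (x : ℕ → Bool) (c : Bool) (j : ℕ) : Prop := ∀ i < k - 1, x (j + i) = c

/-- The word `u` occurs in `x` at position `j`. -/
def IsU (k : ℕ) (x : ℕ → Bool) (j : ℕ) : Prop := x j = true ∧ IsRun k x false (j + 1)

/-- The word `v` occurs in `x` at position `j`. -/
def IsV (k : ℕ) (x : ℕ → Bool) (j : ℕ) : Prop := IsRun k x true j ∧ x (j + (k - 1)) = false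

/-- The recursion satisfied by the set `D` of forbidden positions of a word of length `n` with
letters `x`. -/
structure Dynamics (k n : ℕ) (x : ℕ → Bool) (D : ℕ → Prop) : Prop where
  short : ∀ j, n < j + k → ¬ D j
  step : ∀ j, j + k ≤ n → (D j ↔ (IsRun k x false j ∨ IsRun k x true j ∨ D (j + (k - 1))) ∧
    (IsU k x j ∨ IsV k x j ∨ D (j + k)))

/-- No word of length `k - 1` or `k` that is missing in `Sk k` occurs at position `j`. -/
def IsFree (k : ℕ) (x : ℕ → Bool) (j : ℕ) : Prop :=
  ¬ IsRun k x false j ∧ ¬ IsRun k x true j ∧ ¬ IsU k x j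

lemma Dynamics.of_isV (h : Dynamics k n x D) {j : ℕ} (hj : j + k ≤ n) (hv : IsV k x j) : D j :=
  (h.step j hj).2 ⟨Or.inr (Or.inl hv.1), Or.inr (Or.inl hv)⟩

lemma IsRun.apply_eq {c : Bool} {j i : ℕ} (h : IsRun k x c j) (h1 : j ≤ i) (h2 : i < j + (k - 1)) :
    x i = c := by
  have := h (i - j) (by omega)
  rwa [Nat.add_sub_cancel' h1] at this

lemma IsU.not_isRun {c : Bool} {j : ℕ} (hk : 4 ≤ k) (h : IsU k x j) : ¬ IsRun k x c j := by
  intro hr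
  have h1 := hr.apply_eq (i := j) (by omega) (by omega)
  have h2 := hr.apply_eq (i := j + 1) (by omega) (by omega)
  have h3 := h.1
  have h4 := h.2.apply_eq (i := j + 1) (by omega) (by omega)
  simp_all

lemma Dynamics.iff_of_isU (h : Dynamics k n x D) (hk : 4 ≤ k) {j : ℕ} (hj : j + k ≤ n)
    (hu : IsU k x j) : D j ↔ D (j + (k - 1)) := by
  rw [h.step j hj]
  have := hu.not_isRun hk (c := false)
  have := hu.not_isRun hk (c := true)
  tauto

lemma Dynamics.of_isFree (h : Dynamics k n x D) {j : ℕ} (hj : j + k ≤ n)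
    (hf : IsFree k x j) (hD : D j) : D (j + (k - 1)) ∧ D (j + k) := by
  obtain ⟨h1, h2, h3⟩ := hf
  have h4 : ¬ IsV k x j := fun hv => h2 hv.1
  have := (h.step j hj).1 hD
  tauto

lemma Dynamics.add_of_not_isU_of_not_isV (h : Dynamics k n x D) {j : ℕ} (hj : j + k ≤ n)
    (hu : ¬ IsU k x j) (hv : ¬ IsV k x j) (hD : D j) : D (j + k) := by
  have := (h.step j hj).1 hD
  tauto

lemma Dynamics.not_of_forall_not (h : Dynamics k n x D) (hk : 4 ≤ k) {i : ℕ}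
    (hno : ∀ j, i ≤ j → j + k ≤ n → ¬ IsU k x j ∧ ¬ IsV k x j) (j : ℕ) (hij : i ≤ j) : ¬ D j := by
  intro hD
  by_cases hj : j + k ≤ n
  · obtain ⟨hu, hv⟩ := hno j hij hj
    exact h.not_of_forall_not hk hno (j + k) (by omega)
      (h.add_of_not_isU_of_not_isV hj hu hv hD)
  · exact h.short j (by omega) hD
termination_by n - j

/-! ### Forbidden residues in a window -/

variable [NeZero k]

open Classical in
/-- The residues modulo `k` of the elements of `D` in the window `[i, i + k)`. -/
noncomputable def deadSet (k : ℕ) [NeZero k] (D : ℕ → Prop) (i : ℕ) : Finset (ZMod k) :=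
  Finset.univ.filter fun r => D (i + (r - i).val)

lemma natCast_mem_deadSet {i j : ℕ} (hij : i ≤ j) (hj : j < i + k) :
    (j : ZMod k) ∈ deadSet k D i ↔ D j := by
  have : ((j : ZMod k) - i).val = j - i := by
    rw [← Nat.cast_sub hij]
    exact ZMod.val_natCast_of_lt (by omega)
  simp [deadSet, this, Nat.add_sub_cancel' hij]

lemma exists_natCast_eq (i : ℕ) (r : ZMod k) : ∃ j, i ≤ j ∧ j < i + k ∧ (j : ZMod k) = r :=
  ⟨i + (r - i).val, by omega, Nat.add_lt_add_left (ZMod.val_lt _) i, by simp⟩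

lemma mem_deadSet_of_ne {i : ℕ} {r : ZMod k} (hr : r ≠ i) :
    r ∈ deadSet k D i ↔ r ∈ deadSet k D (i + 1) := by
  obtain ⟨j, h1, h2, rfl⟩ := exists_natCast_eq i r
  have : j ≠ i := by rintro rfl; exact hr rfl
  rw [natCast_mem_deadSet h1 h2, natCast_mem_deadSet (by omega) (by omega)]

lemma self_mem_deadSet {i : ℕ} : (i : ZMod k) ∈ deadSet k D i ↔ D i :=
  natCast_mem_deadSet le_rfl (Nat.lt_add_of_pos_right (NeZero.pos k))

lemma self_mem_deadSet_succ {i : ℕ} : (i : ZMod k) ∈ deadSet k D (i + 1) ↔ D (i + k) := by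
  have := NeZero.pos k
  rw [← natCast_mem_deadSet (k := k) (D := D) (i := i + 1) (j := i + k) (by omega) (by omega)]
  simp

lemma natCast_add_pred (i : ℕ) : ((i + (k - 1) : ℕ) : ZMod k) = i - 1 := by
  rw [Nat.cast_add, Nat.cast_sub (NeZero.pos k)]
  simp
  ring

lemma pred_mem_deadSet_succ {i : ℕ} (hk : 4 ≤ k) :
    (i : ZMod k) - 1 ∈ deadSet k D (i + 1) ↔ D (i + (k - 1)) := by
  rw [← natCast_add_pred, natCast_mem_deadSet (by omega) (by omega)]

lemma Dynamics.deadSet_subset (h : Dynamics k n x D) {i t : ℕ} (hit : i ≤ t) (ht : t + k ≤ n)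
    (hno : ∀ j, i ≤ j → j < t → ¬ IsU k x j ∧ ¬ IsV k x j) :
    deadSet k D i ⊆ deadSet k D t := by
  induction t, hit using Nat.le_induction with
  | base => exact subset_rfl
  | succ t hit ih =>
    refine (ih (by omega) fun j h1 h2 => hno j h1 (by omega)).trans fun r hr => ?_
    by_cases hrt : r = t
    · subst hrt
      obtain ⟨hu, hv⟩ := hno t hit (by omega)
      exact self_mem_deadSet_succ.2
        (h.add_of_not_isU_of_not_isV (by omega) hu hv (self_mem_deadSet.1 hr))
    · exact (mem_deadSet_of_ne hrt).1 hr

/-- A starting point of the dead set is lost when its residue class is passed freely. -/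
lemma Dynamics.notMem_of_isFree (h : Dynamics k n x D) (hk : 4 ≤ k) {i j t : ℕ} (hij : i ≤ j)
    (hjt : j < t) (ht : t + k ≤ n) (hno : ∀ j, i ≤ j → j < t → ¬ IsU k x j ∧ ¬ IsV k x j)
    (hf : IsFree k x j) (hp : (j : ZMod k) - 1 ∉ deadSet k D t) :
    (j : ZMod k) ∉ deadSet k D i := by
  intro hm
  have hDj := self_mem_deadSet.1 (h.deadSet_subset hij (by omega)
    (fun l h1 h2 => hno l h1 (by omega)) hm)
  exact hp (h.deadSet_subset (by omega : j + 1 ≤ t) ht (fun l h1 h2 => hno l (by omega) h2)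
    ((pred_mem_deadSet_succ hk).2 (h.of_isFree (by omega) hf hDj).1))

/-- If the residue class following a starting point is passed freely after the class of that
starting point, it is lost as well. -/
lemma Dynamics.succ_notMem_of_isFree (h : Dynamics k n x D) (hk : 4 ≤ k) {i j t : ℕ}
    (hij : i ≤ j) (hjt : j + (k - 1) < t) (ht : t + k ≤ n)
    (hno : ∀ j, i ≤ j → j < t → ¬ IsU k x j ∧ ¬ IsV k x j)
    (hf : IsFree k x j) (hf' : IsFree k x (j + (k - 1)))
    (hp : ((j + (k - 1) : ℕ) : ZMod k) - 1 ∉ deadSet k D t) :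
    (j : ZMod k) ∉ deadSet k D i := by
  intro hm
  have hDj := self_mem_deadSet.1 (h.deadSet_subset hij (by omega)
    (fun l h1 h2 => hno l h1 (by omega)) hm)
  have := h.notMem_of_isFree hk le_rfl hjt ht (fun l h1 h2 => hno l (by omega) h2) hf' hp
  rw [self_mem_deadSet] at this
  exact this (h.of_isFree (by omega) hf hDj).1

/-! ### Runs between consecutive occurrences -/

lemma not_isRun_false_of_isV (hk : 4 ≤ k) {s j t : ℕ} (hs : IsV k x s)
    (hno : ∀ j, s + 1 ≤ j → j < t → ¬ IsU k x j ∧ ¬ IsV k x j) (hsj : s + 1 ≤ j) (hj : j < t) :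
    ¬ IsRun k x false j := by
  induction j, hsj using Nat.le_induction with
  | base =>
    intro hr
    have h1 := hr.apply_eq (i := s + 1) (by omega) (by omega)
    have h2 := hs.1.apply_eq (i := s + 1) (by omega) (by omega)
    simp_all
  | succ j hsj ih =>
    intro hr
    have hx : x j = false := by
      by_contra hx
      exact (hno j hsj (by omega)).1 ⟨by simpa using hx, hr⟩
    refine ih (by omega) fun i hi => ?_
    rcases Nat.eq_zero_or_pos i with rfl | h0
    · exact hx
    · exact hr.apply_eq (by omega) (by omega)

lemma not_isRun_true_of_isU (hk : 4 ≤ k) {s j t : ℕ} (ht : IsU k x t)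
    (hno : ∀ j, s + 1 ≤ j → j < t → ¬ IsU k x j ∧ ¬ IsV k x j) (hsj : s + 1 ≤ j) (hj : j < t) :
    ¬ IsRun k x true j := by
  intro hr
  have key : ∀ i, j ≤ i → i < t → IsRun k x true i := by
    intro i hi
    induction i, hi using Nat.le_induction with
    | base => exact fun _ => hr
    | succ i hi ih =>
      intro hit
      have hri := ih (by omega)
      have hx : x (i + (k - 1)) = true := by
        by_contra hx
        exact (hno i (by omega) (by omega)).2 ⟨hri, by simpa using hx⟩
      intro l hl
      by_cases hlk : l = k - 2
      · subst hlk
        rw [← hx]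
        congr 1
        omega
      · exact hri.apply_eq (by omega) (by omega)
  have h1 := (key (t - 1) (by omega) (by omega)).apply_eq (i := t + 1) (by omega) (by omega)
  have h2 := ht.2.apply_eq (i := t + 1) (by omega) (by omega)
  simp_all

/-! ### The lower bound -/

/-- The positions strictly between `s` and `t` are not occurrences of `u` or `v`. -/
def NoOcc (k : ℕ) (x : ℕ → Bool) (s t : ℕ) : Prop :=
  ∀ j, s + 1 ≤ j → j < t → ¬ IsU k x j ∧ ¬ IsV k x j

lemma Dynamics.self_mem_iff_of_isU (h : Dynamics k n x D) (hk : 4 ≤ k) {t : ℕ}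
    (ht : t + k ≤ n) (hu : IsU k x t) :
    (t : ZMod k) ∈ deadSet k D t ↔ (t : ZMod k) - 1 ∈ deadSet k D t := by
  rw [self_mem_deadSet, h.iff_of_isU hk ht hu, ← natCast_add_pred,
    natCast_mem_deadSet (by omega) (by omega)]

lemma Dynamics.self_mem_iff_pred_mem_succ (h : Dynamics k n x D) (hk : 4 ≤ k) {s : ℕ}
    (hs : s + k ≤ n) (hu : IsU k x s) :
    (s : ZMod k) ∈ deadSet k D s ↔ (s : ZMod k) - 1 ∈ deadSet k D (s + 1) := by
  rw [self_mem_deadSet, h.iff_of_isU hk hs hu, pred_mem_deadSet_succ hk]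

lemma Dynamics.potU_step_isU (h : Dynamics k n x D) (hk : 4 ≤ k) {s t : ℕ} (hst : s < t)
    (ht : t + k ≤ n) (hno : NoOcc k x s t) (hus : IsU k x s) (hut : IsU k x t)
    (hB : deadSet k D t ≠ Finset.univ) :
    potU (deadSet k D s) (s : ZMod k) ≤ potU (deadSet k D t) (t : ZMod k) + (t - s) := by
  have hd : s + k ≤ t := by
    by_contra hlt
    have h1 := hus.2.apply_eq (i := t) (by omega) (by omega)
    have h2 := hut.1
    simp_all
  refine potU_le_potU_add hk (by omega) (by simp [Nat.cast_sub hst.le])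
    (h.deadSet_subset hst ht hno) hB (fun p _ hp hpt hpt1 => ?_)
    (h.self_mem_iff_of_isU hk ht hut) (fun r hr => mem_deadSet_of_ne hr)
    (h.self_mem_iff_pred_mem_succ hk (by omega) hus)
  obtain ⟨j, h1, h2, rfl⟩ := exists_natCast_eq (t + 2 - k) p
  have hj1 : j ≠ t := by rintro rfl; exact hpt rfl
  have hj2 : j ≠ t + 1 := by rintro rfl; exact hpt1 (by simp)
  refine h.notMem_of_isFree hk (by omega) (by omega : j < t) ht hno ⟨fun hr => ?_,
    not_isRun_true_of_isU hk hut hno (by omega) (by omega), (hno j (by omega) (by omega)).1⟩ hp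
  have h1 := hr.apply_eq (i := t) (by omega) (by omega)
  have h2 := hut.1
  simp_all

lemma Dynamics.potU_step_isV (h : Dynamics k n x D) (hk : 4 ≤ k) {s t : ℕ} (hst : s < t)
    (ht : t + k ≤ n) (hno : NoOcc k x s t) (hus : IsU k x s) (hvt : IsV k x t)
    (hB : deadSet k D t ≠ Finset.univ) :
    potU (deadSet k D s) (s : ZMod k) ≤ potV (deadSet k D t) (t : ZMod k) + (t - s) := by
  classical
  have hrun : ∀ j, s < j → IsRun k x true j → s + k ≤ j := by
    intro j hsj hr
    by_contra hlt
    have h1 := hus.2.apply_eq (i := j) (by omega) (by omega)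
    have h2 := hr.apply_eq (i := j) (by omega) (by omega)
    simp_all
  have hd := hrun t hst hvt.1
  have hex : ∃ j, s < j ∧ IsRun k x true j := ⟨t, hst, hvt.1⟩
  obtain ⟨hl1, hl2⟩ := Nat.find_spec hex
  have hlt : Nat.find hex ≤ t := Nat.find_min' hex ⟨hst, hvt.1⟩
  have hlmin : ∀ j, j < Nat.find hex → s < j → ¬ IsRun k x true j :=
    fun j hj hsj hr => Nat.find_min hex hj ⟨hsj, hr⟩
  generalize Nat.find hex = l at hl1 hl2 hlt hlmin
  have hl3 := hrun l hl1 hl2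
  refine potU_le_potV_add (h := (l : ZMod k)) hk (by omega) (by simp [Nat.cast_sub hst.le])
    (h.deadSet_subset hst ht hno) hB (fun p _ hp hpt hpt1 => ?_)
    (fun hd => by rw [show l = t by omega])
    (self_mem_deadSet.2 (h.of_isV ht hvt)) (fun r hr => mem_deadSet_of_ne hr)
    (h.self_mem_iff_pred_mem_succ hk (by omega) hus)
  obtain ⟨j, h1, h2, rfl⟩ := exists_natCast_eq (l + 2 - k) p
  have hj1 : j ≠ l := by rintro rfl; exact hpt rfl
  have hj2 : j ≠ l + 1 := by rintro rfl; exact hpt1 (by simp)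
  refine h.notMem_of_isFree hk (by omega) (by omega : j < t) ht hno ⟨fun hr => ?_,
    hlmin j (by omega) (by omega), (hno j (by omega) (by omega)).1⟩ hp
  have h1 := hr.apply_eq (i := l) (by omega) (by omega)
  have h2 := hl2.apply_eq (i := l) (by omega) (by omega)
  simp_all

lemma Dynamics.potV_step_isV (h : Dynamics k n x D) (hk : 4 ≤ k) {s t : ℕ} (hst : s < t)
    (ht : t + k ≤ n) (hno : NoOcc k x s t) (hvs : IsV k x s) (hvt : IsV k x t)
    (hB : deadSet k D t ≠ Finset.univ) :
    potV (deadSet k D s) (s : ZMod k) ≤ potV (deadSet k D t) (t : ZMod k) + (t - s) := by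
  have hrun : ∀ j, s < j → IsRun k x true j → s + k ≤ j := by
    intro j hsj hr
    by_contra hlt
    have h1 := hr.apply_eq (i := s + (k - 1)) (by omega) (by omega)
    have h2 := hvs.2
    simp_all
  have hd := hrun t hst hvt.1
  refine potV_le_potV_add hk (by omega)
    (h.deadSet_subset hst ht hno) hB (fun p _ hp hps => ?_)
    (self_mem_deadSet.2 (h.of_isV ht hvt)) (fun r hr => mem_deadSet_of_ne hr)
  obtain ⟨j, h1, h2, rfl⟩ := exists_natCast_eq s p
  have hj1 : j ≠ s := by rintro rfl; exact hps rfl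
  exact h.notMem_of_isFree hk (by omega) (by omega : j < t) ht hno
    ⟨not_isRun_false_of_isV hk hvs hno (by omega) (by omega),
      fun hr => by have := hrun j (by omega) hr; omega, (hno j (by omega) (by omega)).1⟩ hp

lemma Dynamics.potV_step_isU (h : Dynamics k n x D) (hk : 4 ≤ k) {s t : ℕ} (hst : s < t)
    (ht : t + k ≤ n) (hno : NoOcc k x s t) (hvs : IsV k x s) (hut : IsU k x t)
    (hB : deadSet k D t ≠ Finset.univ) :
    potV (deadSet k D s) (s : ZMod k) ≤ potU (deadSet k D t) (t : ZMod k) + (t - s) := by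
  have hfree : ∀ j, s + 1 ≤ j → j < t → IsFree k x j := fun j h1 h2 =>
    ⟨not_isRun_false_of_isV hk hvs hno h1 h2, not_isRun_true_of_isU hk hut hno h1 h2,
      (hno j h1 h2).1⟩
  have hsA : (s : ZMod k) ∈ deadSet k D s := self_mem_deadSet.2 (h.of_isV (by omega) hvs)
  have hd : t = s + (k - 2) ∨ s + k ≤ t := by
    by_contra hn
    rw [not_or, not_le] at hn
    obtain ⟨hn1, hn2⟩ := hn
    by_cases htk : t = s + (k - 1)
    · have h1 := hvs.2
      have h2 := hut.1
      simp_all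
    · have h1 := hvs.1.apply_eq (i := t + 1) (by omega) (by omega)
      have h2 := hut.2.apply_eq (i := t + 1) (by omega) (by omega)
      simp_all
  have hs1 : ((s : ZMod k) + 1 ∈ deadSet k D (s + 1)) → s + 1 < t → D (s + k) := by
    intro hm hlt
    have hm' : D (s + 1) := self_mem_deadSet.1 (by simpa using hm)
    have := (h.of_isFree (by omega) (hfree (s + 1) le_rfl hlt) hm').1
    rwa [show s + 1 + (k - 1) = s + k by omega] at this
  rcases hd with hd | hd
  · rw [show t - s = k - 2 by omega]
    have hstk : s + k = t + 2 := by omega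
    refine potV_le_potU_add_of_overlap hk ?_ (h.deadSet_subset hst ht hno) hB
      (fun p _ hp hpt hpt1 hps => ?_) (fun hm => ?_) (h.self_mem_iff_of_isU hk ht hut)
      (fun r hr => mem_deadSet_of_ne hr) hsA
    · have : ((s + k : ℕ) : ZMod k) = ((t + 2 : ℕ) : ZMod k) := by rw [hstk]
      simpa using this
    · obtain ⟨j, h1, h2, rfl⟩ := exists_natCast_eq s p
      have hj1 : j ≠ s := by rintro rfl; exact hps rfl
      have hj2 : j ≠ t := by rintro rfl; exact hpt rfl
      have hj3 : j ≠ t + 1 := by rintro rfl; exact hpt1 (by simp)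
      exact h.notMem_of_isFree hk (by omega) (by omega : j < t) ht hno
        (hfree j (by omega) (by omega)) hp
    · have := (natCast_mem_deadSet (k := k) (by omega : t ≤ s + k) (by omega)).2
        (hs1 hm (by omega))
      simpa using this
  · refine potV_le_potU_add hk (by omega) (by simp [Nat.cast_sub hst.le])
      (h.deadSet_subset hst ht hno) hB (fun p _ hp hpt => ?_)
      (fun hm => self_mem_deadSet_succ.2 (hs1 hm (by omega))) (fun hd2 p _ hp hpt => ?_)
      (h.self_mem_iff_of_isU hk ht hut) (fun r hr => mem_deadSet_of_ne hr) hsA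
    all_goals
      obtain ⟨j, h1, h2, rfl⟩ := exists_natCast_eq (t + 1 - k) p
      have hj1 : j ≠ t := by rintro rfl; exact hpt rfl
    · exact h.notMem_of_isFree hk (by omega) (by omega : j < t) ht hno
        (hfree j (by omega) (by omega)) hp
    · obtain ⟨l, rfl⟩ : ∃ l, j = l + (k - 1) := ⟨j - (k - 1), by omega⟩
      have := h.succ_notMem_of_isFree hk (by omega : s + 1 ≤ l) (by omega) ht hno
        (hfree _ (by omega) (by omega)) (hfree _ (by omega) (by omega)) hp
      rw [natCast_add_pred]
      simpa using this

lemma Dynamics.pot_le (h : Dynamics k n x D) (hk : 4 ≤ k)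
    (hn : n < potBase k (k - 1) + (2 * k - 1) + (k - 1)) (t : ℕ) (ht : t + k ≤ n) :
    (IsU k x t → potU (deadSet k D t) (t : ZMod k) ≤ n - t - k + 1) ∧
    (IsV k x t → potV (deadSet k D t) (t : ZMod k) ≤ n - t - k + 1) := by
  classical
  by_cases hex : ∃ r, t < r ∧ r + k ≤ n ∧ (IsU k x r ∨ IsV k x r)
  · obtain ⟨h1, h2, h3⟩ := Nat.find_spec hex
    have hmin : NoOcc k x t (Nat.find hex) := by
      intro j hj1 hj2
      have := Nat.find_min hex hj2
      rw [← not_or]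
      exact fun ho => this ⟨hj1, by omega, ho⟩
    generalize Nat.find hex = r at h1 h2 h3 hmin
    obtain ⟨hU, hV⟩ := h.pot_le hk hn r h2
    have hB : deadSet k D r ≠ Finset.univ := by
      intro hB
      have hc : (deadSet k D r).card = k := by rw [hB, Finset.card_univ, ZMod.card]
      rw [potU, pot_of_card_eq hc hk] at hU
      rw [potV, pot_of_card_eq hc hk] at hV
      rcases h3 with h3 | h3
      · have := hU h3
        omega
      · have := hV h3
        omega
    rcases h3 with h3 | h3
    · have hle := hU h3
      refine ⟨fun hu => ?_, fun hv => ?_⟩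
      · have := h.potU_step_isU hk h1 h2 hmin hu h3 hB
        omega
      · have := h.potV_step_isU hk h1 h2 hmin hv h3 hB
        omega
    · have hle := hV h3
      refine ⟨fun hu => ?_, fun hv => ?_⟩
      · have := h.potU_step_isV hk h1 h2 hmin hu h3 hB
        omega
      · have := h.potV_step_isV hk h1 h2 hmin hv h3 hB
        omega
  · have hnot : ∀ j, t + 1 ≤ j → ¬ D j := h.not_of_forall_not hk fun j hj hjn => by
      rw [← not_or]
      exact fun ho => hex ⟨j, hj, hjn, ho⟩
    have hsub : deadSet k D t ⊆ {(t : ZMod k)} := by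
      intro r hr
      rw [Finset.mem_singleton]
      by_contra hne
      obtain ⟨j, h1, h2, rfl⟩ := exists_natCast_eq t r
      have hj : j ≠ t := by rintro rfl; exact hne rfl
      exact hnot j (by omega) ((natCast_mem_deadSet h1 h2).1 hr)
    refine ⟨fun hu => ?_, fun hv => ?_⟩
    · have : deadSet k D t = ∅ := by
        rw [Finset.eq_empty_iff_forall_notMem]
        intro r hr
        have hrt := Finset.mem_singleton.1 (hsub hr)
        rw [hrt, self_mem_deadSet, h.iff_of_isU hk ht hu] at hr
        exact hnot _ (by omega) hr
      rw [potU, pot_of_card_eq_zero (by simp [this])]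
      omega
    · have hc := Finset.card_le_card hsub
      rw [Finset.card_singleton] at hc
      have : 0 < (deadSet k D t).card :=
        Finset.card_pos.2 ⟨_, self_mem_deadSet.2 (h.of_isV ht hv)⟩
      rw [potV, pot_of_card_eq_one (by omega)]
      omega
termination_by n - t

lemma Dynamics.le_of_forall (h : Dynamics k n x D) (hk : 4 ≤ k) (hD : ∀ j < k, D j) :
    potBase k (k - 1) + (2 * k - 1) + (k - 1) ≤ n := by
  classical
  by_contra! hn
  by_cases hex : ∃ r, r + k ≤ n ∧ (IsU k x r ∨ IsV k x r)
  · obtain ⟨h2, h3⟩ := Nat.find_spec hex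
    have hmin : ∀ j, 0 ≤ j → j < Nat.find hex → ¬ IsU k x j ∧ ¬ IsV k x j := by
      intro j _ hj2
      have := Nat.find_min hex hj2
      rw [← not_or]
      exact fun ho => this ⟨by omega, ho⟩
    generalize Nat.find hex = r at h2 h3 hmin
    have hB : deadSet k D r = Finset.univ := by
      rw [Finset.eq_univ_iff_forall]
      intro p
      apply h.deadSet_subset (Nat.zero_le r) h2 hmin
      obtain ⟨j, h1, h2, rfl⟩ := exists_natCast_eq 0 p
      exact (natCast_mem_deadSet h1 h2).2 (hD j (by omega))
    have hc : (deadSet k D r).card = k := by rw [hB, Finset.card_univ, ZMod.card]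
    obtain ⟨hU, hV⟩ := h.pot_le hk hn r h2
    rw [potU, pot_of_card_eq hc hk] at hU
    rw [potV, pot_of_card_eq hc hk] at hV
    rcases h3 with h3 | h3
    · have := hU h3
      omega
    · have := hV h3
      omega
  · refine h.not_of_forall_not hk (i := 0) (fun j _ hj => ?_) 0 le_rfl (hD 0 (by omega))
    rw [← not_or]
    exact fun ho => hex ⟨j, hj, ho⟩

end Dynamics

section Words

variable {k : ℕ}

lemma append_mem_Pref {S : Set Word} {p y : Word} (hp : p ∈ S) (hy : y ∈ Pref (kstar S)) :
    p ++ y ∈ Pref (kstar S) := by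
  obtain ⟨z, L, hL, hz⟩ := hy
  refine ⟨z, p :: L, fun q hq => ?_, by simp [hz]⟩
  rcases List.mem_cons.1 hq with rfl | hq
  exacts [hp, hL q hq]

lemma mem_Pref_of_append {S : Set Word} {y z : Word} (h : y ++ z ∈ Pref S) : y ∈ Pref S := by
  obtain ⟨t, ht⟩ := h
  exact ⟨z ++ t, by rwa [← List.append_assoc]⟩

lemma nil_mem_Pref (S : Set Word) : [] ∈ Pref (kstar S) := ⟨[], [], by simp, by simp⟩

lemma mem_Facts_of_mem_Pref {S : Set Word} {y : Word} (h : y ∈ Pref S) : y ∈ Facts S := by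
  obtain ⟨z, hz⟩ := h
  exact ⟨[], z, by simpa using hz⟩

lemma mem_Sk_of_length_eq {p : Word} (h : p.length = k) (hk : 4 ≤ k) :
    p ∈ Sk k ↔ p ≠ u k ∧ p ≠ v k := by
  have : ¬ k = k - 1 := by omega
  simp [Sk, h, this]

lemma mem_Sk_of_length_eq_pred {p : Word} (h : p.length = k - 1) (hk : 4 ≤ k) :
    p ∈ Sk k ↔ p ≠ List.replicate (k - 1) a ∧ p ≠ List.replicate (k - 1) b := by
  have : ¬ k - 1 = k := by omega
  simp [Sk, h, this]

lemma length_of_mem_Sk {p : Word} (h : p ∈ Sk k) : p.length = k ∨ p.length = k - 1 := by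
  rcases h with h | h
  exacts [Or.inl h.1, Or.inr h.1]

lemma mem_Pref_of_length_lt {y : Word} (hk : 4 ≤ k) (hy : y.length < k) :
    y ∈ Pref (kstar (Sk k)) := by
  have hlast : ∀ p : Word, y ++ List.replicate (k - y.length - 1) b ++ [b] ≠ p ++ [a] := by
    intro p hp
    have := (List.append_inj' hp rfl).2
    simp [a, b] at this
  have hmem : y ++ List.replicate (k - y.length - 1) b ++ [b] ∈ Sk k := by
    rw [mem_Sk_of_length_eq (by simp; omega) hk]
    refine ⟨?_, hlast _⟩
    have : u k = (b :: List.replicate (k - 2) a) ++ [a] := by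
      rw [u, List.cons_append, ← List.replicate_succ']
      congr 2
      omega
    rw [this]
    exact hlast _
  have := append_mem_Pref hmem (nil_mem_Pref _)
  rw [List.append_nil, List.append_assoc] at this
  exact mem_Pref_of_append this

lemma mem_Pref_iff {y : Word} (hk : 4 ≤ k) (hy : k ≤ y.length) :
    y ∈ Pref (kstar (Sk k)) ↔
      (y.take (k - 1) ∈ Sk k ∧ y.drop (k - 1) ∈ Pref (kstar (Sk k))) ∨
      (y.take k ∈ Sk k ∧ y.drop k ∈ Pref (kstar (Sk k))) := by
  constructor
  · rintro ⟨z, L, hL, hz⟩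
    cases L with
    | nil =>
      have := congrArg List.length hz
      simp at this
      omega
    | cons p L =>
      have hp := hL p (by simp)
      have hpk := length_of_mem_Sk hp
      rw [List.flatten_cons] at hz
      have htake : y.take p.length = p := by
        have := congrArg (List.take p.length) hz
        rwa [List.take_left, List.take_append_of_le_length (by omega), eq_comm] at this
      have hdrop : y.drop p.length ∈ Pref (kstar (Sk k)) := by
        refine ⟨z, L, fun q hq => hL q (by simp [hq]), ?_⟩
        have := congrArg (List.drop p.length) hz
        rwa [List.drop_left, List.drop_append_of_le_length (by omega)] at this
      rcases hpk with hpk | hpk <;> rw [hpk] at htake hdrop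
      · exact Or.inr ⟨htake ▸ hp, hdrop⟩
      · exact Or.inl ⟨htake ▸ hp, hdrop⟩
  · rintro (⟨h1, h2⟩ | ⟨h1, h2⟩)
    all_goals
      have := append_mem_Pref h1 h2
      rwa [List.take_append_drop] at this

lemma drop_notMem_Pref {w : Word} (hk : 4 ≤ k) (hw : w ∉ Facts (kstar (Sk k))) {j : ℕ}
    (hj : j < k) : w.drop j ∉ Pref (kstar (Sk k)) := by
  intro hD
  have hwk : k ≤ w.length := by
    by_contra hlt
    exact hw (mem_Facts_of_mem_Pref (mem_Pref_of_length_lt hk (by omega)))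
  apply hw
  rcases Nat.eq_zero_or_pos j with rfl | h0
  · exact mem_Facts_of_mem_Pref (by simpa using hD)
  have hmem : a :: (List.replicate (k - j - 1) a ++ w.take j) ∈ Sk k := by
    rw [mem_Sk_of_length_eq (by simp; omega) hk]
    obtain ⟨l, rfl⟩ : ∃ l, k = l + 2 := ⟨k - 2, by omega⟩
    constructor
    · simp [u, a, b]
    · simp [v, List.replicate_succ, a, b]
  obtain ⟨z, hz⟩ := append_mem_Pref hmem hD
  refine ⟨a :: List.replicate (k - j - 1) a, z, ?_⟩
  convert hz using 1
  simp

lemma exists_drop_mem_Pref {w : Word} (hk : 4 ≤ k) (hw : w ∈ Facts (kstar (Sk k))) :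
    ∃ j < k, w.drop j ∈ Pref (kstar (Sk k)) := by
  have key : ∀ L : List Word, (∀ p ∈ L, p ∈ Sk k) → ∀ x t : Word, x ++ t = L.flatten →
      ∃ j < k, t.drop j ∈ kstar (Sk k) := by
    intro L
    induction L with
    | nil =>
      intro _ x t h
      refine ⟨0, by omega, [], by simp, ?_⟩
      simp at h
      simp [h]
    | cons p L ih =>
      intro hL x t h
      have hpk := length_of_mem_Sk (hL p (by simp))
      rcases x.eq_nil_or_concat' with rfl | hx
      · exact ⟨0, by omega, p :: L, hL, by simpa using h.symm⟩
      have hx0 : 0 < x.length := by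
        obtain ⟨l, c, rfl⟩ := hx
        simp
      rw [List.flatten_cons] at h
      have hd := congrArg (List.drop p.length) h
      rw [List.drop_left] at hd
      rcases le_or_gt p.length x.length with hle | hlt
      · rw [List.drop_append_of_le_length hle] at hd
        exact ih (fun q hq => hL q (by simp [hq])) _ t hd
      · refine ⟨p.length - x.length, by omega, L, fun q hq => hL q (by simp [hq]), ?_⟩
        rw [List.drop_append, List.drop_eq_nil_of_le hlt.le] at hd
        simpa using hd.symm
  obtain ⟨x, y, L, hL, h⟩ := hw
  obtain ⟨j, hj, hm⟩ := key L hL x (w ++ y) (by rw [← List.append_assoc, h])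
  refine ⟨j, hj, (y.drop (j - w.length)), ?_⟩
  rwa [List.drop_append] at hm

lemma take_drop_eq_iff {w p : Word} {j : ℕ} (h : j + p.length ≤ w.length) :
    (w.drop j).take p.length = p ↔
      ∀ i < p.length, w.getD (j + i) false = p.getD i false := by
  constructor
  · intro heq i hi
    conv_rhs => rw [← heq]
    simp [hi]
  · intro hall
    apply List.ext_getElem
    · simp
      omega
    · intro i h1 h2
      have := hall i h2
      rw [List.getD_eq_getElem _ _ h2, List.getD_eq_getElem _ _ (by omega)] at this
      simpa using this

lemma take_drop_eq_replicate_iff {w : Word} {j : ℕ} (h : j + (k - 1) ≤ w.length) (c : Bool) :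
    (w.drop j).take (k - 1) = List.replicate (k - 1) c ↔
      IsRun k (fun i => w.getD i false) c j := by
  have := take_drop_eq_iff (w := w) (p := List.replicate (k - 1) c) (j := j) (by simpa using h)
  rw [List.length_replicate] at this
  rw [this]
  refine forall₂_congr fun i hi => ?_
  simp [hi]

lemma take_drop_eq_u_iff {w : Word} {j : ℕ} (hk : 4 ≤ k) (h : j + k ≤ w.length) :
    (w.drop j).take k = u k ↔ IsU k (fun i => w.getD i false) j := by
  have hlen : (u k).length = k := by simp [u]; omega
  have := take_drop_eq_iff (w := w) (p := u k) (j := j) (by omega)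
  rw [hlen] at this
  rw [this]
  constructor
  · refine fun hall => ⟨by simpa [u, b] using hall 0 (by omega), fun i hi => ?_⟩
    have := hall (i + 1) (by omega)
    simpa [u, a, List.getElem?_replicate, hi, add_assoc, add_comm 1 i] using this
  · rintro ⟨h0, h1⟩ i hi
    cases i with
    | zero => simpa [u, b] using h0
    | succ i =>
      have := h1 i (by omega)
      simpa [u, a, List.getElem?_replicate, show i < k - 1 by omega, add_assoc,
        add_comm 1 i] using this

lemma take_drop_eq_v_iff {w : Word} {j : ℕ} (hk : 4 ≤ k) (h : j + k ≤ w.length) :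
    (w.drop j).take k = v k ↔ IsV k (fun i => w.getD i false) j := by
  have hlen : (v k).length = k := by simp [v]; omega
  have := take_drop_eq_iff (w := w) (p := v k) (j := j) (by omega)
  rw [hlen] at this
  rw [this]
  constructor
  · refine fun hall => ⟨fun i hi => ?_, ?_⟩
    · have := hall i (by omega)
      simpa [v, b, List.getElem?_append, List.getElem?_replicate, hi] using this
    · have := hall (k - 1) (by omega)
      simpa [v, a] using this
  · rintro ⟨h0, h1⟩ i hi
    by_cases hik : i < k - 1
    · have := h0 i hik
      simpa [v, b, List.getElem?_append, List.getElem?_replicate, hik] using this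
    · obtain rfl : i = k - 1 := by omega
      simpa [v, a] using h1

lemma dynamics_of_word (hk : 4 ≤ k) (w : Word) :
    Dynamics k w.length (fun i => w.getD i false)
      (fun j => w.drop j ∉ Pref (kstar (Sk k))) where
  short j hj := not_not.2 (mem_Pref_of_length_lt hk (by simp; omega))
  step j hj := by
    rw [mem_Pref_iff hk (by simp; omega), mem_Sk_of_length_eq (p := (w.drop j).take k) (by simp; omega) hk,
      mem_Sk_of_length_eq_pred (p := (w.drop j).take (k - 1)) (by simp; omega) hk, List.drop_drop, List.drop_drop,
      ← take_drop_eq_replicate_iff (by omega) false, ← take_drop_eq_replicate_iff (by omega) true,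
      ← take_drop_eq_u_iff hk hj, ← take_drop_eq_v_iff hk hj, a, b]
    tauto

lemma mem_Facts_of_length_lt (hk : 4 ≤ k) {w : Word}
    (hw : w.length < 5 * k ^ 2 - 17 * k + 13) : w ∈ Facts (kstar (Sk k)) := by
  by_contra hn
  have : NeZero k := ⟨by omega⟩
  have h := (dynamics_of_word hk w).le_of_forall hk fun j hj => drop_notMem_Pref hk hn hj
  obtain ⟨l, rfl⟩ : ∃ l, k = l + 4 := ⟨k - 4, by omega⟩
  have h1 : l + 4 - 1 - 3 = l := by omega
  have h2 : 5 * (l + 4) - 4 = 5 * l + 16 := by omega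
  have h3 : (5 * l + 16) * l = 5 * l ^ 2 + 16 * l := by ring
  have h4 : 5 * (l + 4) ^ 2 = 5 * l ^ 2 + 40 * l + 80 := by ring
  rw [potBase, h1, h2, h3] at h
  rw [h4] at hw
  omega

end Words

section Construction

variable {k n : ℕ} {x : ℕ → Bool} {D : ℕ → Prop}

lemma Dynamics.add_le (h : Dynamics k n x D) {j : ℕ} (hD : D j) : j + k ≤ n :=
  not_lt.1 fun hlt => h.short j hlt hD

lemma Dynamics.of_add (h : Dynamics k n x D) {j : ℕ} (h1 : D (j + (k - 1))) (h2 : D (j + k)) :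
    D j :=
  (h.step j (by have := h.add_le h2; omega)).2 ⟨Or.inr (Or.inr h1), Or.inr (Or.inr h2)⟩

lemma Dynamics.of_isRun (h : Dynamics k n x D) {c : Bool} {j : ℕ} (hr : IsRun k x c j)
    (h2 : D (j + k)) : D j := by
  refine (h.step j (by have := h.add_le h2; omega)).2 ⟨?_, Or.inr (Or.inr h2)⟩
  cases c
  exacts [Or.inl hr, Or.inr (Or.inl hr)]

lemma Dynamics.of_isU (h : Dynamics k n x D) {j : ℕ} (hu : IsU k x j) (h1 : D (j + (k - 1))) :
    D j :=
  (h.step j (by have := h.add_le h1; omega)).2 ⟨Or.inr (Or.inr h1), Or.inl hu⟩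

/-- Prepending the block `b a^(2k-m-1) b^(k+m-2) a^(k-1) b^(k-1)` to a word enlarges its set of
forbidden positions. -/
lemma Dynamics.of_block (h : Dynamics k n x D) {m : ℕ} (hm : 2 ≤ m) (hmk : m + 1 ≤ k)
    (hn : 5 * k - 2 ≤ n) (x_zero : x 0 = true)
    (x_a : ∀ i, 1 ≤ i → i < 2 * k - m → x i = false)
    (x_b : ∀ i, 2 * k - m ≤ i → i < 3 * k - 2 → x i = true)
    (x_a' : ∀ i, 3 * k - 2 ≤ i → i < 4 * k - 3 → x i = false)
    (x_b' : ∀ i, 4 * k - 3 ≤ i → i < 5 * k - 3 → x i = true)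
    (x_last : x (5 * k - 3) = false)
    (hy : 3 ≤ m → D (5 * k - 4) ∧ ∀ j, k - m + 1 ≤ j → j < k → D (5 * k - 4 + j)) :
    D 0 ∧ ∀ j, k - m ≤ j → j < k → D j := by
  have of_succ : ∀ {p q r}, D q → D r → q = p + (k - 1) → r = p + k → D p := by
    rintro p _ _ h1 h2 rfl rfl
    exact h.of_add h1 h2
  have h1 : D (4 * k - 2) := h.of_isV (by omega) ⟨fun i hi => x_b' _ (by omega) (by omega), by
    rwa [show 4 * k - 2 + (k - 1) = 5 * k - 3 by omega]⟩
  have h2 : D (3 * k - 2) := by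
    refine h.of_isRun (c := false) (fun i hi => x_a' _ (by omega) (by omega)) ?_
    rwa [show 3 * k - 2 + k = 4 * k - 2 by omega]
  have h3 : D (2 * k - 1) := h.of_isV (by omega) ⟨fun i hi => x_b _ (by omega) (by omega),
    x_a' _ (by omega) (by omega)⟩
  have h4 : ∀ j, 3 * k - m ≤ j → j < 3 * k - 1 → D j := by
    intro j hj hj'
    by_cases hj2 : j = 3 * k - 2
    · rwa [hj2]
    obtain ⟨hy0, hy1⟩ := hy (by omega)
    have hy1' : ∀ j, 6 * k - m - 3 ≤ j → j < 6 * k - 4 → D j := by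
      intro j hj hj'
      have := hy1 (j - (5 * k - 4)) (by omega) (by omega)
      rwa [Nat.add_sub_cancel' (by omega)] at this
    have h5 : ∀ j, 5 * k - m - 2 ≤ j → j ≤ 5 * k - 4 → D j := by
      intro j hj hj'
      rcases hj'.eq_or_lt with rfl | hlt
      · exact hy0
      · exact h.of_add (hy1' _ (by omega) (by omega)) (hy1' _ (by omega) (by omega))
    have h6 : ∀ j, 4 * k - m - 1 ≤ j → j ≤ 4 * k - 4 → D j := fun j hj hj' =>
      h.of_add (h5 _ (by omega) (by omega)) (h5 _ (by omega) (by omega))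
    by_cases hj3 : j = 3 * k - 3
    · subst hj3
      exact h.of_isU ⟨x_b _ (by omega) (by omega), fun i hi => x_a' _ (by omega) (by omega)⟩
        (h6 _ (by omega) (by omega))
    · exact h.of_add (h6 _ (by omega) (by omega)) (h6 _ (by omega) (by omega))
  have h5 : ∀ j, 2 * k - m ≤ j → j < 2 * k → D j := by
    intro j hj hj'
    by_cases hj2 : j = 2 * k - 1
    · rwa [hj2]
    · exact h.of_isRun (c := true) (fun i hi => x_b _ (by omega) (by omega))
        (h4 _ (by omega) (by omega))
  have h6 : ∀ j, k - m ≤ j → j < k → D j := by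
    intro j hj hj'
    by_cases hj2 : j = k - m
    · subst hj2
      exact h.of_isRun (c := false) (fun i hi => x_a _ (by omega) (by omega))
        (h5 _ (by omega) (by omega))
    · exact h.of_add (h5 _ (by omega) (by omega)) (h5 _ (by omega) (by omega))
  refine ⟨h.of_isU ⟨x_zero, fun i hi => x_a _ (by omega) (by omega)⟩ ?_, h6⟩
  rw [zero_add]
  exact h6 _ (by omega) (by omega)

lemma Dynamics.forall_of_block (h : Dynamics k n x D) (hk : 4 ≤ k) (x_zero : x 0 = true)
    (x_a : ∀ i, 1 ≤ i → i < k → x i = false)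
    (x_b : ∀ i, k ≤ i → i < 2 * k → x i = true) (x_last : x (2 * k) = false)
    (hy0 : D (2 * k - 1)) (hy : ∀ j, 2 ≤ j → j < k → D (2 * k - 1 + j)) {j : ℕ} (hj : j < k) :
    D j := by
  have hy' : ∀ j, 2 * k + 1 ≤ j → j < 3 * k - 1 → D j := by
    intro j hj hj'
    have := hy (j - (2 * k - 1)) (by omega) (by omega)
    rwa [Nat.add_sub_cancel' (by omega)] at this
  have h1 : ∀ j, k + 1 ≤ j → j < 2 * k → D j := by
    intro j hj hj'
    by_cases hj2 : j = 2 * k - 1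
    · rwa [hj2]
    by_cases hj1 : j = k + 1
    · subst hj1
      refine h.of_isV (by have := h.add_le hy0; omega)
        ⟨fun i hi => x_b _ (by omega) (by omega), ?_⟩
      rwa [show k + 1 + (k - 1) = 2 * k by omega]
    · exact h.of_add (hy' _ (by omega) (by omega)) (hy' _ (by omega) (by omega))
  have h2 : ∀ j, 1 ≤ j → j < k → D j := by
    intro j hj hj'
    by_cases hj1 : j = 1
    · subst hj1
      exact h.of_isRun (c := false) (fun i hi => x_a _ (by omega) (by omega))
        (h1 _ (by omega) (by omega))
    · exact h.of_add (h1 _ (by omega) (by omega)) (h1 _ (by omega) (by omega))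
  rcases Nat.eq_zero_or_pos j with rfl | hj0
  · refine h.of_isU ⟨x_zero, fun i hi => x_a _ (by omega) (by omega)⟩ ?_
    rw [zero_add]
    exact h2 _ (by omega) (by omega)
  · exact h2 j hj0 hj

/-- The nested words from which a minimal uncompletable word is built. -/
def tower (k : ℕ) : ℕ → Word
  | 0 => [b, a]
  | i + 1 => (b :: (List.replicate (2 * k - 3 - i) a ++ (List.replicate (k + i) b ++
      (List.replicate (k - 1) a ++ List.replicate (k - 1) b)))) ++ tower k i

lemma exists_tower_eq (hk : 4 ≤ k) {i : ℕ} (hi : i + 3 ≤ k) :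
    ∃ t, tower k i = b :: a :: t := by
  cases i with
  | zero => exact ⟨[], rfl⟩
  | succ i =>
    obtain ⟨l, hl⟩ : ∃ l, 2 * k - 3 - i = l + 1 := ⟨2 * k - 4 - i, by omega⟩
    rw [tower, hl, List.replicate_succ]
    exact ⟨_, rfl⟩

lemma length_tower (hk : 4 ≤ k) {i : ℕ} (hi : i + 3 ≤ k) :
    (tower k i).length = 2 + i * (5 * k - 4) := by
  induction i with
  | zero => simp [tower]
  | succ i ih =>
    simp only [tower, List.length_append, List.length_cons, List.length_replicate,
      ih (by omega), Nat.succ_mul]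
    omega

lemma tower_notMem_Pref (hk : 4 ≤ k) {i : ℕ} (hi : i + 1 + 3 ≤ k) :
    tower k (i + 1) ∉ Pref (kstar (Sk k)) ∧ ∀ j, k - (i + 2) ≤ j → j < k →
      (tower k (i + 1)).drop j ∉ Pref (kstar (Sk k)) := by
  obtain ⟨t, ht⟩ := exists_tower_eq hk (i := i) (by omega)
  have hlen := length_tower hk (i := i + 1) hi
  have hmul : (i + 1) * (5 * k - 4) = i * (5 * k - 4) + (5 * k - 4) := Nat.succ_mul _ _
  have hget : ∀ j, (tower k (i + 1)).getD j false =
      if j = 0 then true else if j < 2 * k - 2 - i then false else if j < 3 * k - 2 then true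
      else if j < 4 * k - 3 then false else if j < 5 * k - 3 then true
      else if j = 5 * k - 3 then false else t.getD (j - (5 * k - 2)) false := by
    intro j
    rw [tower, ht]
    simp only [List.getD_eq_getElem?_getD, List.getElem?_append, List.getElem?_cons,
      List.getElem?_replicate, List.length_cons, List.length_append, List.length_replicate, a, b]
    split_ifs <;> first | rfl | omega | (congr 2; omega)
  have hdrop : ∀ j, (tower k (i + 1)).drop (5 * k - 4 + j) = (tower k i).drop j := by
    intro j
    rw [tower, List.drop_append, List.drop_eq_nil_of_le (by simp; omega), List.nil_append]
    congr 1
    simp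
    omega
  refine (dynamics_of_word hk (tower k (i + 1))).of_block (m := i + 2) (by omega) (by omega)
    (by omega) ?_ ?_ ?_ ?_ ?_ ?_ ?_
  · exact (hget 0).trans (if_pos rfl)
  · intro j h1 h2
    simp only [hget]
    split_ifs <;> first | rfl | omega
  · intro j h1 h2
    simp only [hget]
    split_ifs <;> first | rfl | omega
  · intro j h1 h2
    simp only [hget]
    split_ifs <;> first | rfl | omega
  · intro j h1 h2
    simp only [hget]
    split_ifs <;> first | rfl | omega
  · simp only [hget]
    split_ifs <;> first | rfl | omega
  · intro hi'
    obtain ⟨i, rfl⟩ : ∃ l, i = l + 1 := ⟨i - 1, by omega⟩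
    have ih := tower_notMem_Pref hk (i := i) (by omega)
    refine ⟨?_, fun j h1 h2 => ?_⟩
    · rw [← Nat.add_zero (5 * k - 4), hdrop]
      exact ih.1
    · rw [hdrop]
      exact ih.2 j (by omega) h2

/-- An uncompletable word of minimal length. -/
def shortestUncompletable (k : ℕ) : Word :=
  (b :: (List.replicate (k - 1) a ++ List.replicate (k - 1) b)) ++ tower k (k - 3)

lemma length_shortestUncompletable (hk : 4 ≤ k) :
    (shortestUncompletable k).length = 5 * k ^ 2 - 17 * k + 13 := by
  obtain ⟨l, rfl⟩ : ∃ l, k = l + 4 := ⟨k - 4, by omega⟩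
  have h1 : l + 4 - 3 = l + 1 := by omega
  have h2 : 5 * (l + 4) - 4 = 5 * l + 16 := by omega
  have h3 : (l + 1) * (5 * l + 16) = 5 * l ^ 2 + 21 * l + 16 := by ring
  have h4 : 5 * (l + 4) ^ 2 = 5 * l ^ 2 + 40 * l + 80 := by ring
  rw [shortestUncompletable, List.length_append, length_tower hk (by omega), h1, h2, h3, h4]
  simp
  omega

lemma shortestUncompletable_notMem_Facts (hk : 4 ≤ k) :
    shortestUncompletable k ∉ Facts (kstar (Sk k)) := by
  intro hw
  obtain ⟨j, hj, hD⟩ := exists_drop_mem_Pref hk hw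
  obtain ⟨t, ht⟩ := exists_tower_eq hk (i := k - 3) (by omega)
  have hget : ∀ j, (shortestUncompletable k).getD j false =
      if j = 0 then true else if j < k then false else if j < 2 * k then true
      else if j = 2 * k then false else t.getD (j - (2 * k + 1)) false := by
    intro j
    rw [shortestUncompletable, ht]
    simp only [List.getD_eq_getElem?_getD, List.getElem?_append, List.getElem?_cons,
      List.getElem?_replicate, List.length_cons, List.length_append, List.length_replicate, a, b]
    split_ifs <;> first | rfl | omega | (congr 2; omega)
  have hdrop : ∀ j, (shortestUncompletable k).drop (2 * k - 1 + j) = (tower k (k - 3)).drop j := by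
    intro j
    rw [shortestUncompletable, List.drop_append, List.drop_eq_nil_of_le (by simp; omega),
      List.nil_append]
    congr 1
    simp
    omega
  obtain ⟨i, hi⟩ : ∃ i, k - 3 = i + 1 := ⟨k - 4, by omega⟩
  have ih := tower_notMem_Pref hk (i := i) (by omega)
  rw [hi] at hdrop
  refine (dynamics_of_word hk (shortestUncompletable k)).forall_of_block hk ?_ ?_ ?_ ?_ ?_ ?_ hj hD
  · exact (hget 0).trans (if_pos rfl)
  · intro j h1 h2
    simp only [hget]
    split_ifs <;> first | rfl | omega
  · intro j h1 h2
    simp only [hget]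
    split_ifs <;> first | rfl | omega
  · simp only [hget]
    split_ifs <;> first | rfl | omega
  · rw [← Nat.add_zero (2 * k - 1), hdrop]
    exact ih.1
  · intro j h1 h2
    rw [hdrop]
    exact ih.2 j (by omega) h2

end Construction

theorem statement2 (k : ℕ) (hk : 4 ≤ k) :
    (∃ w : Word, w.length = 5 * k ^ 2 - 17 * k + 13 ∧ w ∉ Facts (kstar (Sk k))) ∧
    (∀ w : Word, w.length < 5 * k ^ 2 - 17 * k + 13 → w ∈ Facts (kstar (Sk k))) := by
  exact ⟨⟨shortestUncompletable k, length_shortestUncompletable hk,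
    shortestUncompletable_notMem_Facts hk⟩, fun _ hw => mem_Facts_of_length_lt hk hw⟩

end Restivo
end

section
/- Let k ≥ 4, let w be a word over Σ = {a,b}, and let j with k ≤ j ≤ |w|−1 be a forbidden position in w with respect to S_k. Then position j − k is forbidden in w with respect to S_k if and only if either position j − 1 is forbidden in w with respect to S_k, or the factor of w consisting of its letters at (1-indexed) positions j−k+1 through j−1 equals a^{k−1} or b^{k−1}. -/
namespace Restivo

/-- Prepending a word of `S` to a prefix of a word of `S*` gives a prefix of a word of `S*`. -/
theorem append_mem_Pref_kstar {S : Set Word} {s x : Word} (hs : s ∈ S)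
    (hx : x ∈ Pref (kstar S)) : s ++ x ∈ Pref (kstar S) := by
  obtain ⟨z, L, hL, h⟩ := hx
  refine ⟨z, s :: L, ?_, by simp [h]⟩
  simpa using ⟨hs, hL⟩

/-- A nonempty prefix of a word of `S*` which is at least as long as every word of `S`
splits as a word of `S` followed by a prefix of a word of `S*`. -/
theorem exists_take_mem_of_mem_Pref_kstar {S : Set Word} {x : Word} (hne : x ≠ [])
    (hlen : ∀ s ∈ S, s.length ≤ x.length) (hx : x ∈ Pref (kstar S)) :
    ∃ s ∈ S, x.take s.length = s ∧ x.drop s.length ∈ Pref (kstar S) := by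
  obtain ⟨z, L, hL, h⟩ := hx
  cases L with
  | nil => simp_all
  | cons s L =>
    have hs : s ∈ S := hL s (by simp)
    have hle := hlen s hs
    rw [List.flatten_cons] at h
    refine ⟨s, hs, ?_, z, L, fun y hy => hL y (by simp [hy]), ?_⟩
    · simpa [List.take_append_of_le_length hle] using (congrArg (List.take s.length) h).symm
    · simpa [List.drop_append_of_le_length hle] using congrArg (List.drop s.length) h

theorem statement3 (k : ℕ) (hk : 4 ≤ k) (w : Word) (j : ℕ)
    (hjk : k ≤ j) (hjw : j < w.length)
    (hj : Forbidden (Sk k) w j) :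
    Forbidden (Sk k) w (j - k) ↔
      (Forbidden (Sk k) w (j - 1) ∨
        (w.drop (j - k)).take (k - 1) = List.replicate (k - 1) a ∨
        (w.drop (j - k)).take (k - 1) = List.replicate (k - 1) b) := by
  have hlen : (w.drop (j - k)).length = w.length - (j - k) := List.length_drop
  have hdrop : (w.drop (j - k)).drop (k - 1) = w.drop (j - 1) := by
    rw [List.drop_drop]; congr 1; omega
  constructor
  · intro h
    by_contra! hcon
    obtain ⟨h1, h2, h3⟩ := hcon
    refine h ?_
    rw [← List.take_append_drop (k - 1) (w.drop (j - k)), hdrop]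
    refine append_mem_Pref_kstar (Or.inr ⟨?_, h2, h3⟩) (not_not.mp h1)
    rw [List.length_take]; omega
  · intro h hmem
    obtain ⟨s, hs, htake, hrest⟩ := exists_take_mem_of_mem_Pref_kstar
      (List.ne_nil_of_length_pos (by omega))
      (by rintro s (⟨hs, -⟩ | ⟨hs, -⟩) <;> omega) hmem
    rcases hs with ⟨hs, -⟩ | ⟨hs, h2, h3⟩
    · refine hj ?_
      rwa [hs, List.drop_drop, Nat.sub_add_cancel hjk] at hrest
    · rw [hs] at htake hrest
      rw [hdrop] at hrest
      rw [htake] at h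
      rcases h with h | h | h
      exacts [h hrest, h2 h, h3 h]

end Restivo
end

section
/- Let k ≥ 4 and let w be a word over Σ = {a,b} in which u = b a^{k−1} occurs at position s (i.e. the letters of w at 1-indexed positions s+1, …, s+k spell u). Then position s is forbidden in w with respect to S_k if and only if position s + k − 1 is forbidden in w with respect to S_k. -/
namespace Restivo

/-- Prepending a word of `S` preserves membership in `Pref (kstar S)`. -/
theorem append_mem_pref_kstar {S : Set Word} {p x : Word} (hp : p ∈ S)
    (hx : x ∈ Pref (kstar S)) : p ++ x ∈ Pref (kstar S) := by
  obtain ⟨z, L, hL, hz⟩ := hx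
  exact ⟨z, p :: L, by simpa using ⟨hp, hL⟩, by simp [hz]⟩

/-- A nonempty prefix of a word of `S*` begins with a word of `S`, up to completion. -/
theorem exists_append_of_mem_pref_kstar {S : Set Word} {x : Word} (hx : x ∈ Pref (kstar S))
    (hne : x ≠ []) : ∃ q ∈ S, ∃ r ∈ kstar S, ∃ z, x ++ z = q ++ r := by
  obtain ⟨z, L, hL, hz⟩ := hx
  cases L with
  | nil => simp_all
  | cons q L =>
    simp only [List.forall_mem_cons] at hL
    exact ⟨q, hL.1, L.flatten, ⟨L, hL.2, rfl⟩, z, by simpa using hz.symm⟩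

/-- The word `u` with its last letter split off. -/
theorem u_eq_append (n : ℕ) : u (n + 2) = (b :: List.replicate n a) ++ [a] := by
  simp [u, List.replicate_succ']

theorem cons_replicate_mem_Sk {n : ℕ} (hn : 1 ≤ n) :
    b :: List.replicate n a ∈ Sk (n + 2) := by
  obtain ⟨m, rfl⟩ := Nat.exists_eq_add_of_le' hn
  refine Or.inr ⟨by simp, ?_, ?_⟩ <;> simp [List.replicate_succ, a, b]

theorem u_append_mem_pref_iff {n : ℕ} (hn : 1 ≤ n) (y : Word) :
    u (n + 2) ++ y ∈ Pref (kstar (Sk (n + 2))) ↔ a :: y ∈ Pref (kstar (Sk (n + 2))) := by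
  constructor
  · intro h
    obtain ⟨q, hq, r, hr, z, hz⟩ := exists_append_of_mem_pref_kstar h (by simp [u])
    rcases hq with ⟨hlen, hu, -⟩ | ⟨hlen, -⟩
    · rw [List.append_assoc] at hz
      exact absurd (List.append_inj_left hz (by simp [u, hlen])).symm hu
    · rw [u_eq_append, List.append_assoc, List.append_assoc] at hz
      have hr' := List.append_inj_right hz (by simp [hlen])
      exact ⟨z, by simpa [← hr'] using hr⟩
  · intro h
    simpa [u_eq_append] using append_mem_pref_kstar (cons_replicate_mem_Sk hn) h

theorem statement4 (k : ℕ) (hk : 4 ≤ k) (w : Word) (s : ℕ)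
    (hocc : OccursAt (u k) w s) :
    Forbidden (Sk k) w s ↔ Forbidden (Sk k) w (s + (k - 1)) := by
  obtain ⟨n, rfl⟩ := Nat.exists_eq_add_of_le' (show 2 ≤ k by omega)
  obtain ⟨y, hy⟩ : ∃ y, w.drop s = u (n + 2) ++ y :=
    ⟨(w.drop s).drop (u (n + 2)).length, by
      conv_lhs => rw [← List.take_append_drop (u (n + 2)).length (w.drop s), hocc.2]⟩
  have hy' : w.drop (s + (n + 2 - 1)) = a :: y := by
    rw [← List.drop_drop, hy, u_eq_append, List.append_assoc]
    exact List.drop_left' (by simp)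
  unfold Forbidden
  rw [hy, hy', u_append_mem_pref_iff (by omega)]

end Restivo
end

section
/- Let k ≥ 4 and let w be a word over Σ = {a,b} in which v = b^{k−1} a occurs at position s (i.e. the letters of w at 1-indexed positions s+1, …, s+k spell v). Then position s is forbidden in w with respect to S_k. -/
namespace Restivo

theorem v_length {k : ℕ} (hk : 1 ≤ k) : (v k).length = k := by
  simp [v]; omega

theorem OccursAt.prefix_drop {p w : Word} {s : ℕ} (h : OccursAt p w s) : p <+: w.drop s :=
  List.prefix_iff_eq_take.mpr h.2.symm

theorem not_prefix_v_of_mem_Sk {k : ℕ} (hk : 1 ≤ k) {x : Word} (hx : x ∈ Sk k) :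
    ¬ x <+: v k := by
  intro hpre
  rcases hx with ⟨hlen, -, hne⟩ | ⟨hlen, -, hne⟩
  · exact hne (hpre.eq_of_length (hlen.trans (v_length hk).symm))
  · have hrep : List.replicate (k - 1) b <+: v k := List.prefix_append _ _
    have hxr := List.prefix_of_prefix_length_le hpre hrep (by simp [hlen])
    exact hne (hxr.eq_of_length (by simp [hlen]))

theorem length_le_of_mem_Sk {k : ℕ} {x : Word} (hx : x ∈ Sk k) : x.length ≤ k := by
  rcases hx with ⟨hlen, -⟩ | ⟨hlen, -⟩ <;> omega

theorem statement5 (k : ℕ) (hk : 4 ≤ k) (w : Word) (s : ℕ)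
    (hocc : OccursAt (v k) w s) :
    Forbidden (Sk k) w s := by
  rintro ⟨z, L, hL, hflat⟩
  have hk1 : 1 ≤ k := by omega
  have hv : v k <+: L.flatten :=
    hflat ▸ hocc.prefix_drop.trans (List.prefix_append _ _)
  cases L with
  | nil =>
    have := hv.length_le
    rw [v_length hk1] at this
    simp at this
    omega
  | cons x L =>
    have hx : x ∈ Sk k := hL x List.mem_cons_self
    have hxpre : x <+: (x :: L).flatten := List.prefix_append _ _
    exact not_prefix_v_of_mem_Sk hk1 hx (List.prefix_of_prefix_length_le hxpre hv
      ((length_le_of_mem_Sk hx).trans_eq (v_length hk1).symm))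

end Restivo
end

section
/- Let k ≥ 4, let φ : Σ* → Σ* be the morphism exchanging the letters, φ(a) = b and φ(b) = a, and for a word x let x⁻ denote its mirror image (reversal). Then { x⁻ : x ∈ S_k } = { φ(x) : x ∈ S_k }; consequently, for every word w over Σ, w ∉ Fact(S_k*) if and only if φ(w⁻) ∉ Fact(S_k*), and w is a minimal uncompletable word for S_k if and only if φ(w⁻) is. -/
namespace Restivo

/-- The antimorphic involution `w ↦ φ(w⁻)`: reverse the word and exchange the two letters. -/
def mirror (w : Word) : Word := w.reverse.map (fun c => !c)

theorem mirror_mirror (w : Word) : mirror (mirror w) = w := by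
  simp [mirror, Function.comp_def]

theorem mirror_append (x y : Word) : mirror (x ++ y) = mirror y ++ mirror x := by
  simp [mirror]

theorem length_mirror (w : Word) : (mirror w).length = w.length := by
  simp [mirror]

theorem mirror_eq_iff {x y : Word} : mirror x = y ↔ x = mirror y :=
  ⟨fun h => by rw [← h, mirror_mirror], fun h => by rw [h, mirror_mirror]⟩

theorem mirror_replicate (n : ℕ) (c : Bool) :
    mirror (List.replicate n c) = List.replicate n (!c) := by
  simp [mirror]

theorem mirror_u (k : ℕ) : mirror (u k) = v k := by
  simp [mirror, u, v, a, b]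

theorem mirror_v (k : ℕ) : mirror (v k) = u k := by
  rw [← mirror_u, mirror_mirror]

theorem mirror_mem_Sk {k : ℕ} {w : Word} (h : w ∈ Sk k) : mirror w ∈ Sk k := by
  rcases h with ⟨hl, hu, hv⟩ | ⟨hl, ha, hb⟩
  · left
    refine ⟨(length_mirror w).trans hl, ?_, ?_⟩
    · rwa [Ne, mirror_eq_iff, mirror_u]
    · rwa [Ne, mirror_eq_iff, mirror_v]
  · right
    refine ⟨(length_mirror w).trans hl, ?_, ?_⟩
    · rwa [Ne, mirror_eq_iff, mirror_replicate]
    · rwa [Ne, mirror_eq_iff, mirror_replicate]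

theorem mirror_flatten (L : List Word) : mirror L.flatten = (L.reverse.map mirror).flatten := by
  induction L with
  | nil => rfl
  | cons x L ih => simp [mirror_append, ih]

theorem mirror_mem_kstar {S : Set Word} (hS : ∀ x ∈ S, mirror x ∈ S) {w : Word}
    (h : w ∈ kstar S) : mirror w ∈ kstar S := by
  obtain ⟨L, hL, rfl⟩ := h
  refine ⟨L.reverse.map mirror, ?_, (mirror_flatten L).symm⟩
  intro x hx
  obtain ⟨y, hy, rfl⟩ := List.mem_map.1 hx
  exact hS y (hL y (List.mem_reverse.1 hy))

theorem mirror_mem_Facts {S : Set Word} (hS : ∀ x ∈ S, mirror x ∈ S) {w : Word}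
    (h : w ∈ Facts (kstar S)) : mirror w ∈ Facts (kstar S) := by
  obtain ⟨x, y, h⟩ := h
  refine ⟨mirror y, mirror x, ?_⟩
  simpa [mirror_append] using mirror_mem_kstar hS h

theorem mirror_mem_Facts_iff {S : Set Word} (hS : ∀ x ∈ S, mirror x ∈ S) (w : Word) :
    mirror w ∈ Facts (kstar S) ↔ w ∈ Facts (kstar S) :=
  ⟨fun h => by simpa [mirror_mirror] using mirror_mem_Facts hS h, mirror_mem_Facts hS⟩

theorem minUncompletable_mirror_iff {S : Set Word} (hS : ∀ x ∈ S, mirror x ∈ S) (w : Word) :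
    MinUncompletable S (mirror w) ↔ MinUncompletable S w := by
  rw [MinUncompletable, MinUncompletable, mirror_mem_Facts_iff hS, length_mirror]

theorem statement12 (k : ℕ) (hk : 4 ≤ k) :
    (List.reverse '' Sk k = List.map (fun c => !c) '' Sk k) ∧
    (∀ w : Word,
      w ∉ Facts (kstar (Sk k)) ↔ w.reverse.map (fun c => !c) ∉ Facts (kstar (Sk k))) ∧
    (∀ w : Word,
      MinUncompletable (Sk k) w ↔ MinUncompletable (Sk k) (w.reverse.map (fun c => !c))) := by
  have hS : ∀ x ∈ Sk k, mirror x ∈ Sk k := fun _ => mirror_mem_Sk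
  refine ⟨?_, fun w => (not_congr (mirror_mem_Facts_iff hS w)).symm,
    fun w => (minUncompletable_mirror_iff hS w).symm⟩
  ext w
  constructor
  · rintro ⟨x, hx, rfl⟩
    exact ⟨mirror x, hS x hx, by simp [mirror, Function.comp_def]⟩
  · rintro ⟨x, hx, rfl⟩
    exact ⟨mirror x, hS x hx, by simp [mirror]⟩

end Restivo
end
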